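/- arXiv:1402.6796 — 3 statements merged into one kernel-verified Lean document; each statement's English description precedes it below -/
import Mathlib

section
/- Let g be a non-compact real simple Lie algebra without complex structure, λ the highest root of the positive restricted root system Σ+(g,a), and g_λ its restricted root space. For any two non-zero highest root vectors X_λ, X'_λ ∈ g_λ, there exists g ∈ G_C = Int(g_C) such that g·X_λ = X'_λ. -/
/-!
Common definitions: a complex simple Lie algebra `gC`, real forms, Cartan decompositions,
restricted roots, inner automorphism groups, adjoint orbits and the closure ordering.
-/

open LieAlgebra Set

namespace SmallestOrbitPaper

variable {gC : Type*} [LieRing gC] [LieAlgebra ℂ gC]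

/-- `g` is a real form of the complex Lie algebra `gC`:
an `ℝ`-subspace closed under the bracket with `gC = g ⊕ √-1 g`. -/
structure IsRealForm (g : Submodule ℝ gC) : Prop where
  lie_mem : ∀ x ∈ g, ∀ y ∈ g, ⁅x, y⁆ ∈ g
  spans : ∀ z : gC, ∃ x ∈ g, ∃ y ∈ g, z = x + Complex.I • y
  indep : ∀ x ∈ g, Complex.I • x ∈ g → x = 0

/-- `g = k ⊕ p` is a Cartan decomposition of the real form `g`
(the Killing form is negative definite on `k` and positive definite on `p`). -/
structure IsCartanDecomposition (g k p : Submodule ℝ gC) : Prop where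
  k_le : k ≤ g
  p_le : p ≤ g
  sup_eq : k ⊔ p = g
  inf_eq : k ⊓ p = ⊥
  lie_kk : ∀ x ∈ k, ∀ y ∈ k, ⁅x, y⁆ ∈ k
  lie_kp : ∀ x ∈ k, ∀ y ∈ p, ⁅x, y⁆ ∈ p
  lie_pp : ∀ x ∈ p, ∀ y ∈ p, ⁅x, y⁆ ∈ k
  killing_neg : ∀ x ∈ k, x ≠ 0 → ((killingForm ℂ gC) x x).re < 0
  killing_pos : ∀ x ∈ p, x ≠ 0 → 0 < ((killingForm ℂ gC) x x).re

/-- `a` is a maximal abelian subspace of `p`. -/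
structure IsMaximalAbelianIn (a p : Submodule ℝ gC) : Prop where
  le : a ≤ p
  abelian : ∀ x ∈ a, ∀ y ∈ a, ⁅x, y⁆ = 0
  maximal : ∀ x ∈ p, (∀ y ∈ a, ⁅x, y⁆ = 0) → x ∈ a

/-- The restricted root space `g_ξ ⊆ g` for a functional `ξ` on `a`. -/
def restrictedRootSpace (g a : Submodule ℝ gC) (ξ : Module.Dual ℝ a) : Set gC :=
  {x | x ∈ g ∧ ∀ H : a, ⁅(H : gC), x⁆ = ((ξ H : ℝ) : ℂ) • x}

/-- The restricted root system `Σ(g, a)`. -/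
def restrictedRoots (g a : Submodule ℝ gC) : Set (Module.Dual ℝ a) :=
  {ξ | ξ ≠ 0 ∧ ∃ x ∈ restrictedRootSpace g a ξ, x ≠ 0}

/-- `P` is a positive system `Σ⁺(g, a)` of the restricted root system. -/
structure IsPositiveSystem (g a : Submodule ℝ gC) (P : Set (Module.Dual ℝ a)) : Prop where
  subset : P ⊆ restrictedRoots g a
  total : ∀ ξ ∈ restrictedRoots g a, ξ ∈ P ∨ -ξ ∈ P
  not_both : ∀ ξ ∈ P, -ξ ∉ P
  add_mem : ∀ ξ ∈ P, ∀ η ∈ P, ξ + η ∈ restrictedRoots g a → ξ + η ∈ P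

/-- `lam` is the highest root of `Σ⁺(g,a)`: it is positive and `lam - ξ` is a sum of
positive roots for every root `ξ`. -/
def IsHighestRestrictedRoot (g a : Submodule ℝ gC) (P : Set (Module.Dual ℝ a))
    (lam : Module.Dual ℝ a) : Prop :=
  lam ∈ P ∧ ∀ ξ ∈ restrictedRoots g a, lam - ξ ∈ AddSubmonoid.closure P

/-- The exponential of a nilpotent endomorphism (a finite sum, since the nilpotency
index is at most `finrank ℂ gC`). -/
noncomputable def expNilpotent (f : Module.End ℂ gC) : Module.End ℂ gC :=
  ∑ n ∈ Finset.range (Module.finrank ℂ gC + 1), (n.factorial : ℂ)⁻¹ • f ^ n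

/-- The group of automorphisms of `gC` generated by `exp (ad x)` for `x ∈ S` with `ad x`
nilpotent.  For `S = gC` this is `Int(gC)`; for `S = g` a noncompact real form,
this is `Int(g)` (acting on `gC`). -/
def innerAut (S : Set gC) : Subgroup (gC ≃ₗ[ℂ] gC) :=
  Subgroup.closure
    {e | ∃ x ∈ S, IsNilpotent (ad ℂ gC x) ∧ (e : gC →ₗ[ℂ] gC) = expNilpotent (ad ℂ gC x)}

/-- The orbit of `x` under a subgroup `H` of automorphisms of `gC`. -/
def adOrbit (H : Subgroup (gC ≃ₗ[ℂ] gC)) (x : gC) : Set gC := {y | ∃ h ∈ H, h x = y}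

/-- `O` is a non-zero complex nilpotent (adjoint) orbit in `gC`. -/
def IsComplexNilpotentOrbit (O : Set gC) : Prop :=
  ∃ x : gC, x ≠ 0 ∧ IsNilpotent (ad ℂ gC x) ∧ O = adOrbit (innerAut (univ : Set gC)) x

/-- `O` is a non-zero complex nilpotent orbit meeting the real form `g`,
i.e. `O ∈ (N_g / G_ℂ) \ {[0]}`. -/
def IsComplexNilpotentOrbitMeeting (g : Submodule ℝ gC) (O : Set gC) : Prop :=
  IsComplexNilpotentOrbit O ∧ ∃ y ∈ O, y ∈ g

/-- `O` is the minimum of `(N_g / G_ℂ) \ {[0]}` with respect to the closure ordering;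
this is the orbit `O_{min, g}` of the paper. -/
def IsMinOrbitMeeting [TopologicalSpace gC] (g : Submodule ℝ gC) (O : Set gC) : Prop :=
  IsComplexNilpotentOrbitMeeting g O ∧
    ∀ O', IsComplexNilpotentOrbitMeeting g O' → O ⊆ closure O'

/-- `O` is the minimal nilpotent orbit `O_min^{G_ℂ}` of `gC`, i.e. the minimum of
`(N / G_ℂ) \ {[0]}` with respect to the closure ordering. -/
def IsMinNilpotentOrbit [TopologicalSpace gC] (O : Set gC) : Prop :=
  IsComplexNilpotentOrbit O ∧ ∀ O', IsComplexNilpotentOrbit O' → O ⊆ closure O'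

/-- `O` is a non-zero real nilpotent orbit in the real form `g`, i.e. an orbit of
`G = Int(g)` through a non-zero nilpotent element of `g`. -/
def IsRealNilpotentOrbit (g : Submodule ℝ gC) (O : Set gC) : Prop :=
  ∃ x : gC, x ∈ g ∧ x ≠ 0 ∧ IsNilpotent (ad ℂ gC x) ∧ O = adOrbit (innerAut (g : Set gC)) x

/-- The complex dimension of the adjoint orbit through `x`: `dim_ℂ [gC, x]`. -/
noncomputable def cdim (x : gC) : ℕ := Module.finrank ℂ (LinearMap.range (ad ℂ gC x))

/-- The real dimension of the `Int(g)`-orbit through `x ∈ g`: `dim_ℝ [g, x]`. -/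
noncomputable def rdim (g : Submodule ℝ gC) (x : gC) : ℕ :=
  Module.finrank ℝ (Submodule.map ((ad ℂ gC x : gC →ₗ[ℂ] gC).restrictScalars ℝ) g)

/-- The dimension of the `K_ℂ`-orbit through `x`: `dim_ℂ [k_ℂ, x]`. -/
noncomputable def kdim (k : Submodule ℝ gC) (x : gC) : ℕ :=
  Module.finrank ℂ (Submodule.map (ad ℂ gC x : gC →ₗ[ℂ] gC) (Submodule.span ℂ (k : Set gC)))

/-- `(g, k)` is of Hermitian type: the center of `k` is non-zero. -/
def IsHermitianPair (k : Submodule ℝ gC) : Prop :=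
  ∃ z ∈ k, z ≠ 0 ∧ ∀ x ∈ k, ⁅z, x⁆ = 0

/-! ### Roots of the complex Lie algebra with respect to a Cartan subalgebra -/

/-- The root space of a functional `χ` on a Cartan subalgebra `hC` of `gC`. -/
def rootSpaceC (hC : LieSubalgebra ℂ gC) (χ : Module.Dual ℂ hC) : Set gC :=
  {x | ∀ H : hC, ⁅(H : gC), x⁆ = χ H • x}

/-- The root system `Δ(gC, hC)`. -/
def rootsC (hC : LieSubalgebra ℂ gC) : Set (Module.Dual ℂ hC) :=
  {χ | χ ≠ 0 ∧ ∃ x ∈ rootSpaceC hC χ, x ≠ 0}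

/-- `PC` is a positive system `Δ⁺(gC, hC)`. -/
structure IsPositiveSystemC (hC : LieSubalgebra ℂ gC) (PC : Set (Module.Dual ℂ hC)) : Prop where
  subset : PC ⊆ rootsC hC
  total : ∀ χ ∈ rootsC hC, χ ∈ PC ∨ -χ ∈ PC
  not_both : ∀ χ ∈ PC, -χ ∉ PC
  add_mem : ∀ χ ∈ PC, ∀ ψ ∈ PC, χ + ψ ∈ rootsC hC → χ + ψ ∈ PC

/-- `φ` is the highest root of `Δ⁺(gC, hC)`. -/
def IsHighestRootC (hC : LieSubalgebra ℂ gC) (PC : Set (Module.Dual ℂ hC))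
    (φ : Module.Dual ℂ hC) : Prop :=
  φ ∈ PC ∧ ∀ χ ∈ rootsC hC, φ - χ ∈ AddSubmonoid.closure PC

/-- The simple system `Π` of the positive system `PC` (indecomposable positive roots). -/
def simpleSystemC (hC : LieSubalgebra ℂ gC) (PC : Set (Module.Dual ℂ hC)) :
    Set (Module.Dual ℂ hC) :=
  {α | α ∈ PC ∧ ¬∃ β ∈ PC, ∃ γ ∈ PC, α = β + γ}

/-- `χ` restricts to zero on `a`; for a simple root this says that the corresponding node
of the Satake diagram is black. -/
def VanishesOnA (hC : LieSubalgebra ℂ gC) (a : Submodule ℝ gC) (hah : ∀ x ∈ a, x ∈ hC)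
    (χ : Module.Dual ℂ hC) : Prop :=
  ∀ x : gC, ∀ hx : x ∈ a, χ ⟨x, hah x hx⟩ = 0

/-- `χ` and `ψ` have the same restriction to `a`; for two distinct white simple roots this
says that they are joined by an arrow in the Satake diagram. -/
def SameRestrictionOnA (hC : LieSubalgebra ℂ gC) (a : Submodule ℝ gC)
    (hah : ∀ x ∈ a, x ∈ hC) (χ ψ : Module.Dual ℂ hC) : Prop :=
  ∀ x : gC, ∀ hx : x ∈ a, χ ⟨x, hah x hx⟩ = ψ ⟨x, hah x hx⟩

/-- Two distinct white (non-black) simple roots joined by an arrow in the Satake diagram. -/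
def JoinedByArrow (hC : LieSubalgebra ℂ gC) (a : Submodule ℝ gC) (hah : ∀ x ∈ a, x ∈ hC)
    (PC : Set (Module.Dual ℂ hC)) (α β : Module.Dual ℂ hC) : Prop :=
  α ∈ simpleSystemC hC PC ∧ β ∈ simpleSystemC hC PC ∧ α ≠ β ∧
    ¬VanishesOnA hC a hah α ∧ ¬VanishesOnA hC a hah β ∧ SameRestrictionOnA hC a hah α β

/-- The positive system `PC` of `Δ(gC,hC)` is compatible with the positive system `P` of
`Σ(g,a)` (the ordering on `h` extends the ordering on `a`): the non-zero restriction of a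
positive root is a positive restricted root. -/
def CompatiblePositiveSystems (hC : LieSubalgebra ℂ gC) (a : Submodule ℝ gC)
    (hah : ∀ x ∈ a, x ∈ hC) (PC : Set (Module.Dual ℂ hC)) (P : Set (Module.Dual ℝ a)) : Prop :=
  ∀ χ ∈ PC, ¬VanishesOnA hC a hah χ →
    ∃ ξ ∈ P, ∀ x : gC, ∀ hx : x ∈ a, χ ⟨x, hah x hx⟩ = ((ξ ⟨x, hx⟩ : ℝ) : ℂ)

/-- `φ` is a real root: it vanishes on `√-1 t = {x ∈ hC | √-1 x ∈ k}`. -/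
def IsRealRootWRT (hC : LieSubalgebra ℂ gC) (k : Submodule ℝ gC)
    (φ : Module.Dual ℂ hC) : Prop :=
  ∀ x : gC, ∀ hx : x ∈ hC, Complex.I • x ∈ k → φ ⟨x, hx⟩ = 0

/-! ### The classification list -/

/-- `f` intertwines the Lie bracket of `g ⊆ gC` and the commutator bracket of the
associative algebra `A`. -/
def BracketCompatible (g : Submodule ℝ gC) {A : Type*} [Ring A] [Algebra ℝ A]
    (f : g →ₗ[ℝ] A) : Prop :=
  ∀ x y z : g, (z : gC) = ⁅(x : gC), (y : gC)⁆ → f z = f x * f y - f y * f x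

/-- `g ≅ su*(2m) = sl(m, ℍ)`: quaternionic `m × m` matrices whose trace has zero real
part. -/
def IsomorphicToSuStar (g : Submodule ℝ gC) (m : ℕ) : Prop :=
  ∃ f : g →ₗ[ℝ] Matrix (Fin m) (Fin m) (Quaternion ℝ),
    Function.Injective f ∧ BracketCompatible g f ∧
    (LinearMap.range f : Set (Matrix (Fin m) (Fin m) (Quaternion ℝ))) =
      {X | (Matrix.trace X).re = 0}

/-- The Lorentz form `diag(1, …, 1, -1)` of signature `(n-1, 1)`. -/
noncomputable def lorentzJ (n : ℕ) : Matrix (Fin n) (Fin n) ℝ :=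
  Matrix.diagonal fun i => if (i : ℕ) < n - 1 then 1 else -1

/-- `g ≅ so(n-1, 1)`. -/
def IsomorphicToSoLorentz (g : Submodule ℝ gC) (n : ℕ) : Prop :=
  ∃ f : g →ₗ[ℝ] Matrix (Fin n) (Fin n) ℝ,
    Function.Injective f ∧ BracketCompatible g f ∧
    (LinearMap.range f : Set (Matrix (Fin n) (Fin n) ℝ)) =
      {X | X.transpose * lorentzJ n + lorentzJ n * X = 0}

/-- The quaternionic Hermitian form `diag(1_p, -1_q)`. -/
noncomputable def spJ (p q : ℕ) : Matrix (Fin (p + q)) (Fin (p + q)) (Quaternion ℝ) :=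
  Matrix.diagonal fun i => if (i : ℕ) < p then 1 else -1

/-- `g ≅ sp(p, q)`. -/
def IsomorphicToSpPQ (g : Submodule ℝ gC) (p q : ℕ) : Prop :=
  ∃ f : g →ₗ[ℝ] Matrix (Fin (p + q)) (Fin (p + q)) (Quaternion ℝ),
    Function.Injective f ∧ BracketCompatible g f ∧
    (LinearMap.range f : Set (Matrix (Fin (p + q)) (Fin (p + q)) (Quaternion ℝ))) =
      {X | X.conjTranspose * spJ p q + spJ p q * X = 0}

/-- `g ≅ e_{6(-26)}`: among noncompact absolutely simple real Lie algebras this is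
characterized by `dim_ℝ g = 78` together with the character
`dim p - dim k = -26` of a Cartan decomposition `g = k ⊕ p`. -/
def IsE6Minus26 (g k p : Submodule ℝ gC) : Prop :=
  Module.finrank ℝ g = 78 ∧ (Module.finrank ℝ p : ℤ) - (Module.finrank ℝ k : ℤ) = -26

/-- `g ≅ f_{4(-20)}`: characterized by `dim_ℝ g = 52` and character `-20`. -/
def IsF4Minus20 (g k p : Submodule ℝ gC) : Prop :=
  Module.finrank ℝ g = 52 ∧ (Module.finrank ℝ p : ℤ) - (Module.finrank ℝ k : ℤ) = -20

/-- `g` is isomorphic to one of `su*(2k)` (k ≥ 2), `so(n-1,1)` (n ≥ 5), `sp(p,q)`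
(p, q ≥ 1), `f_{4(-20)}`, `e_{6(-26)}`. -/
def InClassificationList (g k p : Submodule ℝ gC) : Prop :=
  (∃ m : ℕ, 2 ≤ m ∧ IsomorphicToSuStar g m) ∨
  (∃ n : ℕ, 5 ≤ n ∧ IsomorphicToSoLorentz g n) ∨
  (∃ p' q' : ℕ, 1 ≤ p' ∧ 1 ≤ q' ∧ IsomorphicToSpPQ g p' q') ∨
  IsF4Minus20 g k p ∨ IsE6Minus26 g k p

/-! ### Groups: `K_ℂ`, `K`, `M`, `A`, and `MA`-orbits -/

/-- Topology on the automorphism group of `gC`, induced from pointwise convergence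
(equivalently, for finite-dimensional `gC`, the standard topology). -/
noncomputable instance autTopology [TopologicalSpace gC] :
    TopologicalSpace (gC ≃ₗ[ℂ] gC) :=
  TopologicalSpace.induced (fun e => (e : gC → gC)) Pi.topologicalSpace

/-- The exponentials `exp (ad z)` of elements `z ∈ S` with `ad z` diagonalizable:
`h = exp (ad z)` is characterized by `h x = e^c • x` on eigenvectors, which span. -/
def expSemisimpleSet (S : Set gC) : Set (gC ≃ₗ[ℂ] gC) :=
  {h | ∃ z ∈ S, Submodule.span ℂ {x : gC | ∃ c : ℂ, ⁅z, x⁆ = c • x} = ⊤ ∧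
      ∀ (c : ℂ) (x : gC), ⁅z, x⁆ = c • x → h x = Complex.exp c • x}

/-- The connected subgroup of `Int(gC)` with Lie algebra the (algebraic, reductive)
subalgebra spanned by `S`: generated by exponentials of nilpotent and of semisimple
elements of `S`.  For `S = k_ℂ` this is the group `K_ℂ`. -/
def connectedSubgroupOf (S : Set gC) : Subgroup (gC ≃ₗ[ℂ] gC) :=
  Subgroup.closure
    ({e | ∃ x ∈ S, IsNilpotent (ad ℂ gC x) ∧ (e : gC →ₗ[ℂ] gC) = expNilpotent (ad ℂ gC x)}
      ∪ expSemisimpleSet S)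

/-- The subgroup `A = exp a`: `exp (ad H)` for `H ∈ a` is characterized by its action on
the (spanning) eigenvectors of `ad H`, which has real eigenvalues. -/
def expAOf (a : Submodule ℝ gC) : Set (gC ≃ₗ[ℂ] gC) :=
  {h | ∃ H ∈ a, Submodule.span ℂ {x : gC | ∃ c : ℝ, ⁅H, x⁆ = (c : ℂ) • x} = ⊤ ∧
      ∀ (c : ℝ) (x : gC), ⁅H, x⁆ = (c : ℂ) • x → h x = ((Real.exp c : ℝ) : ℂ) • x}

/-- `M = Z_K(a)`, the centralizer of `a` in `K`. -/
def centralizerSetOf (K : Subgroup (gC ≃ₗ[ℂ] gC)) (a : Submodule ℝ gC) :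
    Set (gC ≃ₗ[ℂ] gC) :=
  {h | h ∈ K ∧ ∀ x ∈ a, h x = x}

/-- `N_K(a)`, the normalizer of `a` in `K`. -/
def normalizerSetOf (K : Subgroup (gC ≃ₗ[ℂ] gC)) (a : Submodule ℝ gC) :
    Set (gC ≃ₗ[ℂ] gC) :=
  {h | h ∈ K ∧ ∀ x : gC, x ∈ a ↔ h x ∈ a}

/-- The `MA`-orbit of `x`, where `M = Z_K(a)` and `A = exp a`. -/
def MAOrbit (K : Subgroup (gC ≃ₗ[ℂ] gC)) (a : Submodule ℝ gC) (x : gC) : Set gC :=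
  {y | ∃ m ∈ centralizerSetOf K a, ∃ t ∈ expAOf a, (m * t) x = y}

/-- `K` is a maximal compact subgroup of `G`. -/
def IsMaximalCompactIn [TopologicalSpace gC] (G K : Subgroup (gC ≃ₗ[ℂ] gC)) : Prop :=
  K ≤ G ∧ IsCompact (K : Set (gC ≃ₗ[ℂ] gC)) ∧
    ∀ K' : Subgroup (gC ≃ₗ[ℂ] gC), K' ≤ G → IsCompact (K' : Set (gC ≃ₗ[ℂ] gC)) →
      K ≤ K' → K' = K

/-- `M₀`, the identity component of `M = Z_K(a)`. -/
def MZero [TopologicalSpace gC] (K : Subgroup (gC ≃ₗ[ℂ] gC)) (a : Submodule ℝ gC) :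
    Set (gC ≃ₗ[ℂ] gC) :=
  {h | ∃ hh : h ∈ centralizerSetOf K a,
    (⟨h, hh⟩ : centralizerSetOf K a) ∈
      connectedComponent (α := centralizerSetOf K a)
        ⟨1, K.one_mem, fun x _ => rfl⟩}

/-- The `M₀A`-orbit of `x`. -/
def MZeroAOrbit [TopologicalSpace gC] (K : Subgroup (gC ≃ₗ[ℂ] gC)) (a : Submodule ℝ gC)
    (x : gC) : Set gC :=
  {y | ∃ m ∈ MZero K a, ∃ t ∈ expAOf a, (m * t) x = y}



/-! ### Auxiliary lemmas for the proof -/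

section Aux

set_option linter.unusedSectionVars false

lemma aux_pow_finrank {V : Type*} [AddCommGroup V] [Module ℂ V] [FiniteDimensional ℂ V]
    {f : Module.End ℂ V} (hf : IsNilpotent f) (n : ℕ) (hn : Module.finrank ℂ V ≤ n) :
    f ^ n = 0 := by
  have h1 := LinearMap.aeval_self_charpoly f
  rw [_root_.IsNilpotent.charpoly_eq_X_pow_finrank hf] at h1
  simp only [map_pow, Polynomial.aeval_X] at h1
  exact pow_eq_zero_of_le hn h1

/-- An element which is an eigenvector of a commutator action is nilpotent. -/
lemma aux_nilp {V : Type*} [AddCommGroup V] [Module ℂ V] [FiniteDimensional ℂ V]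
    (A B : Module.End ℂ V) (c : ℂ) (hc : c ≠ 0) (h : A * B - B * A = c • B) :
    IsNilpotent B := by
  by_contra hB
  have hpow : ∀ n : ℕ, A * B ^ n - B ^ n * A = ((n : ℂ) * c) • B ^ n := by
    intro n
    induction n with
    | zero => simp
    | succ n ih =>
      have e1 : A * B ^ (n + 1) - B ^ (n + 1) * A
          = (A * B ^ n - B ^ n * A) * B + B ^ n * (A * B - B * A) := by
        rw [pow_succ]; noncomm_ring
      rw [e1, ih, h, smul_mul_assoc, mul_smul_comm, ← pow_succ, ← add_smul]
      congr 1
      push_cast; ring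
  let T : Module.End ℂ (Module.End ℂ V) := LinearMap.mulLeft ℂ A - LinearMap.mulRight ℂ A
  have hev : ∀ n : ℕ, T.HasEigenvalue ((n : ℂ) * c) := by
    intro n
    apply Module.End.hasEigenvalue_of_hasEigenvector (x := B ^ n)
    refine ⟨?_, fun h0 => hB ⟨n, h0⟩⟩
    rw [Module.End.mem_eigenspace_iff]
    simpa [T] using hpow n
  have hfin : Finite T.Eigenvalues := by
    have : Fintype T.Eigenvalues := inferInstance
    exact Finite.of_fintype _
  have hinj : Function.Injective (fun n : ℕ => (⟨(n : ℂ) * c, hev n⟩ : T.Eigenvalues)) := by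
    intro m n hmn
    have := congrArg Subtype.val hmn
    simpa [hc] using this
  exact @not_injective_infinite_finite ℕ T.Eigenvalues _ hfin _ hinj

variable {L : Type*} [LieRing L] [LieAlgebra ℂ L] [FiniteDimensional ℂ L]

lemma aux_ad_nilp (h e : L) (c : ℂ) (hc : c ≠ 0) (he : ⁅h, e⁆ = c • e) :
    IsNilpotent (ad ℂ L e) := by
  apply aux_nilp (ad ℂ L h) (ad ℂ L e) c hc
  ext z
  have h1 : ⁅⁅h, e⁆, z⁆ = ⁅h, ⁅e, z⁆⁆ - ⁅e, ⁅h, z⁆⁆ := lie_lie h e z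
  rw [he, smul_lie] at h1
  simpa using h1.symm

lemma aux_exp_isUnit {f : Module.End ℂ L} (hf : IsNilpotent f) : IsUnit (expNilpotent f) := by
  have h1 : expNilpotent f = 1 + f * ∑ n ∈ Finset.range (Module.finrank ℂ L),
      ((n + 1).factorial : ℂ)⁻¹ • f ^ n := by
    rw [expNilpotent, Finset.sum_range_succ']
    simp only [Nat.factorial_zero, Nat.cast_one, inv_one, pow_zero, one_smul]
    rw [add_comm, Finset.mul_sum]
    congr 1
    refine Finset.sum_congr rfl fun n _ => ?_
    rw [mul_smul_comm, pow_succ']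
  rw [h1]
  apply IsNilpotent.isUnit_one_add
  apply Commute.isNilpotent_mul_right _ hf
  apply Commute.sum_right
  intro n _
  exact ((Commute.refl f).pow_right n).smul_right _

lemma aux_exp_apply {f : Module.End ℂ L} (hf : IsNilpotent f) (v : L) (hv : f (f (f v)) = 0) :
    expNilpotent f v = v + f v + (2 : ℂ)⁻¹ • f (f v) := by
  have h0 : ∀ n, 3 ≤ n → (f ^ n) v = 0 := by
    intro n hn
    obtain ⟨m, rfl⟩ := Nat.exists_eq_add_of_le' hn
    rw [pow_add, Module.End.mul_apply]
    have : (f ^ 3) v = 0 := by simpa [pow_succ] using hv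
    rw [this, map_zero]
  have h1 : expNilpotent f v = ∑ n ∈ Finset.range (Module.finrank ℂ L + 1 + 3),
      (n.factorial : ℂ)⁻¹ • (f ^ n) v := by
    rw [expNilpotent, LinearMap.sum_apply]
    simp only [LinearMap.smul_apply]
    apply Finset.sum_subset
    · intro n hn; simp only [Finset.mem_range] at *; omega
    · intro n _ hn
      simp only [Finset.mem_range, not_lt] at hn
      rw [aux_pow_finrank hf n (by omega)]; simp
  have h2 : ∑ n ∈ Finset.range 3, (n.factorial : ℂ)⁻¹ • (f ^ n) v
      = ∑ n ∈ Finset.range (Module.finrank ℂ L + 1 + 3), (n.factorial : ℂ)⁻¹ • (f ^ n) v := by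
    apply Finset.sum_subset
    · intro n hn; simp only [Finset.mem_range] at *; omega
    · intro n _ hn
      simp only [Finset.mem_range, not_lt] at hn
      rw [h0 n hn, smul_zero]
  rw [h1, ← h2]
  simp [Finset.sum_range_succ, pow_succ]

lemma aux_exp_mem (x : L) (hx : IsNilpotent (ad ℂ L x)) :
    ∃ w ∈ innerAut (univ : Set L), ∀ v, w v = expNilpotent (ad ℂ L x) v := by
  refine ⟨LinearEquiv.ofBijective (expNilpotent (ad ℂ L x))
    ((Module.End.isUnit_iff _).1 (aux_exp_isUnit hx)), ?_, fun v => rfl⟩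
  apply Subgroup.subset_closure
  exact ⟨x, mem_univ _, hx, by ext v; rfl⟩

/-- The Weyl element of an `sl₂`-triple maps a lowest weight vector `y` of weight `-2`
to `(1/2) [e, [e, y]]`. -/
lemma aux_weyl (h e f : L) (hef : ⁅e, f⁆ = h) (hhe : ⁅h, e⁆ = (2 : ℂ) • e)
    (hhf : ⁅h, f⁆ = (-2 : ℂ) • f) :
    ∃ w ∈ innerAut (univ : Set L), ∀ y, ⁅h, y⁆ = (-2 : ℂ) • y → ⁅f, y⁆ = 0 →
      ⁅e, ⁅e, ⁅e, y⁆⁆⁆ = 0 → w y = (2 : ℂ)⁻¹ • ⁅e, ⁅e, y⁆⁆ := by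
  have ne := aux_ad_nilp h e 2 (by norm_num) hhe
  have nf := aux_ad_nilp h (-f) (-2) (by norm_num) (by rw [lie_neg, hhf, smul_neg])
  obtain ⟨we, hwe, hwe'⟩ := aux_exp_mem e ne
  obtain ⟨wf, hwf, hwf'⟩ := aux_exp_mem (-f) nf
  refine ⟨we * wf * we, mul_mem (mul_mem hwe hwf) hwe, ?_⟩
  intro y hy hfy heee
  have hfe : ⁅f, e⁆ = -h := by rw [← lie_skew, hef]
  have f1 : ⁅f, ⁅e, y⁆⁆ = (2 : ℂ) • y := by
    rw [leibniz_lie, hfe, hfy, lie_zero, neg_lie, hy]; module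
  have h1 : ⁅h, ⁅e, y⁆⁆ = 0 := by
    rw [leibniz_lie, hhe, hy, lie_smul, smul_lie]; module
  have f2 : ⁅f, ⁅e, ⁅e, y⁆⁆⁆ = (2 : ℂ) • ⁅e, y⁆ := by
    rw [leibniz_lie, hfe, neg_lie, h1, f1, lie_smul]; module
  have s1 : we y = y + ⁅e, y⁆ + (2 : ℂ)⁻¹ • ⁅e, ⁅e, y⁆⁆ := by
    rw [hwe', aux_exp_apply ne y (by simpa using heee)]; simp
  have s2 : wf (y + ⁅e, y⁆ + (2 : ℂ)⁻¹ • ⁅e, ⁅e, y⁆⁆) = (2 : ℂ)⁻¹ • ⁅e, ⁅e, y⁆⁆ := by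
    rw [hwf', aux_exp_apply nf]
    · simp only [ad_apply, neg_lie, lie_add, lie_smul, hfy, f1, f2, lie_neg,
        smul_zero, neg_zero, zero_add]
      module
    · simp only [ad_apply, neg_lie, lie_add, lie_smul, hfy, f1, f2, lie_neg,
        smul_zero, neg_zero, zero_add]
  have s3 : we ((2 : ℂ)⁻¹ • ⁅e, ⁅e, y⁆⁆) = (2 : ℂ)⁻¹ • ⁅e, ⁅e, y⁆⁆ := by
    rw [map_smul, hwe', aux_exp_apply ne]
    · simp [heee]
    · simp [heee]
  rw [LinearEquiv.mul_apply, LinearEquiv.mul_apply, s1, s2, s3]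

/-- Two commuting-type `sl₂`-triples: a conjugation criterion. -/
lemma aux_conj (h e f e' f' x : L) (hef : ⁅e, f⁆ = h) (hhe : ⁅h, e⁆ = (2 : ℂ) • e)
    (hhf : ⁅h, f⁆ = (-2 : ℂ) • f) (hef' : ⁅e', f'⁆ = h) (hhe' : ⁅h, e'⁆ = (2 : ℂ) • e')
    (hhf' : ⁅h, f'⁆ = (-2 : ℂ) • f') (hff : ⁅f', f⁆ = 0)
    (hx : ⁅e', ⁅e', f⁆⁆ = (-2 : ℂ) • x) (hx' : ⁅e', x⁆ = 0) :
    ∃ w ∈ innerAut (univ : Set L), w e = x := by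
  obtain ⟨w, hw, hw'⟩ := aux_weyl h e f hef hhe hhf
  obtain ⟨w₂, hw₂, hw₂'⟩ := aux_weyl h e' f' hef' hhe' hhf'
  have heh : ⁅e, ⁅e, f⁆⁆ = (-2 : ℂ) • e := by
    rw [hef, ← lie_skew, hhe]; module
  have k1 : w f = -e := by
    rw [hw' f hhf (lie_self f) (by rw [heh]; simp), heh]; module
  have k2 : w₂ f = -x := by
    rw [hw₂' f hhf hff (by rw [hx, lie_smul, hx', smul_zero]), hx]; module
  refine ⟨w₂ * w⁻¹, mul_mem hw₂ (inv_mem hw), ?_⟩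
  have k3 : w⁻¹ e = -f := by
    have : w (-f) = e := by rw [map_neg, k1, neg_neg]
    rw [← this]
    exact w.symm_apply_apply (-f)
  rw [LinearEquiv.mul_apply, k3, map_neg, k2, neg_neg]

/-- Real part of the Killing form. -/
noncomputable def auxB (x y : L) : ℝ := (killingForm ℂ L x y).re

lemma auxB_add_left (x y z : L) : auxB (x + y) z = auxB x z + auxB y z := by simp [auxB]
lemma auxB_add_right (x y z : L) : auxB x (y + z) = auxB x y + auxB x z := by simp [auxB]
lemma auxB_smul_left (r : ℝ) (x y : L) : auxB ((r : ℂ) • x) y = r * auxB x y := by simp [auxB]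
lemma auxB_smul_right (r : ℝ) (x y : L) : auxB x ((r : ℂ) • y) = r * auxB x y := by simp [auxB]
lemma auxB_neg_left (x y : L) : auxB (-x) y = -auxB x y := by simp [auxB]
lemma auxB_neg_right (x y : L) : auxB x (-y) = -auxB x y := by simp [auxB]
lemma auxB_comm (x y : L) : auxB x y = auxB y x := by
  rw [auxB, auxB, LieModule.traceForm_comm]
lemma auxB_lie (x y z : L) : auxB ⁅x, y⁆ z = auxB x ⁅y, z⁆ := by
  rw [auxB, auxB, LieModule.traceForm_apply_lie_apply]

lemma aux_smul_mem (S : Submodule ℝ L) (r : ℝ) {x : L} (hx : x ∈ S) : (r : ℂ) • x ∈ S := by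
  have := S.smul_mem r hx
  rwa [← Complex.coe_smul] at this

/-- `y` is the image of `x` under the Cartan involution. -/
def AuxTh (k p : Submodule ℝ L) (x y : L) : Prop :=
  ∃ u ∈ k, ∃ v ∈ p, x = u + v ∧ y = u - v

variable {g k p a : Submodule ℝ L}

lemma AuxTh.exists (hkp : IsCartanDecomposition g k p) {x : L} (hx : x ∈ g) :
    ∃ y, AuxTh k p x y := by
  rw [← hkp.sup_eq, Submodule.mem_sup] at hx
  obtain ⟨u, hu, v, hv, rfl⟩ := hx
  exact ⟨u - v, u, hu, v, hv, rfl, rfl⟩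

lemma AuxTh.add {x y x' y' : L} (h : AuxTh k p x y) (h' : AuxTh k p x' y') :
    AuxTh k p (x + x') (y + y') := by
  obtain ⟨u, hu, v, hv, rfl, rfl⟩ := h
  obtain ⟨u', hu', v', hv', rfl, rfl⟩ := h'
  exact ⟨u + u', add_mem hu hu', v + v', add_mem hv hv', by abel, by abel⟩

lemma AuxTh.smul {x y : L} (h : AuxTh k p x y) (r : ℝ) :
    AuxTh k p ((r : ℂ) • x) ((r : ℂ) • y) := by
  obtain ⟨u, hu, v, hv, rfl, rfl⟩ := h
  exact ⟨(r : ℂ) • u, aux_smul_mem k r hu, (r : ℂ) • v, aux_smul_mem p r hv,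
    smul_add _ _ _, smul_sub _ _ _⟩

lemma aux_split (hkp : IsCartanDecomposition g k p) {u u' v v' : L} (hu : u ∈ k) (hu' : u' ∈ k)
    (hv : v ∈ p) (hv' : v' ∈ p) (h : u + v = u' + v') : u = u' ∧ v = v' := by
  have h1 : u - u' = v' - v := by
    rw [sub_eq_sub_iff_add_eq_add, h, add_comm]
  have h2 : u - u' ∈ k ⊓ p := ⟨sub_mem hu hu', by rw [h1]; exact sub_mem hv' hv⟩
  rw [hkp.inf_eq, Submodule.mem_bot] at h2
  refine ⟨sub_eq_zero.1 h2, ?_⟩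
  rw [h2] at h1
  exact (sub_eq_zero.1 h1.symm).symm

lemma AuxTh.neg_root (hkp : IsCartanDecomposition g k p) (ha : IsMaximalAbelianIn a p)
    {ξ : Module.Dual ℝ a} {x y : L} (h : AuxTh k p x y) (hx : x ∈ restrictedRootSpace g a ξ)
    (H : a) : ⁅(H : L), y⁆ = ((-ξ H : ℝ) : ℂ) • y := by
  obtain ⟨u, hu, v, hv, rfl, rfl⟩ := h
  have h1 := hx.2 H
  have hHp : (H : L) ∈ p := ha.le H.2
  have m1 : ⁅(H : L), u⁆ ∈ p := by
    rw [← lie_skew]; exact neg_mem (hkp.lie_kp u hu _ hHp)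
  have m2 : ⁅(H : L), v⁆ ∈ k := hkp.lie_pp _ hHp v hv
  obtain ⟨e1, e2⟩ := aux_split hkp m2 (aux_smul_mem k (ξ H) hu) m1 (aux_smul_mem p (ξ H) hv)
    (by rw [← smul_add, ← h1, lie_add, add_comm])
  rw [lie_sub, e1, e2]
  push_cast
  module

lemma AuxTh.form_neg (hkp : IsCartanDecomposition g k p) {x y : L} (h : AuxTh k p x y)
    (hx : x ≠ 0) : auxB x y < 0 := by
  obtain ⟨u, hu, v, hv, rfl, rfl⟩ := h
  have e : auxB (u + v) (u - v) = auxB u u - auxB v v := by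
    rw [sub_eq_add_neg, auxB_add_left, auxB_add_right, auxB_add_right, auxB_neg_right,
      auxB_neg_right, auxB_comm v u]
    ring
  rw [e]
  have hk : u ≠ 0 → auxB u u < 0 := hkp.killing_neg u hu
  have hp : v ≠ 0 → 0 < auxB v v := hkp.killing_pos v hv
  by_cases hu0 : u = 0
  · have hv0 : v ≠ 0 := by rintro rfl; exact hx (by rw [hu0, add_zero])
    have : auxB u u = 0 := by rw [hu0]; simp [auxB]
    linarith [hp hv0]
  · by_cases hv0 : v = 0
    · have : auxB v v = 0 := by rw [hv0]; simp [auxB]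
      linarith [hk hu0]
    · linarith [hk hu0, hp hv0]

lemma AuxTh.lie_mem (hkp : IsCartanDecomposition g k p) (ha : IsMaximalAbelianIn a p)
    {ξ : Module.Dual ℝ a} {x y : L} (h : AuxTh k p x y) (hx : x ∈ restrictedRootSpace g a ξ) :
    ⁅x, y⁆ ∈ a := by
  have hy := h.neg_root hkp ha hx
  apply ha.maximal
  · obtain ⟨u, hu, v, hv, rfl, rfl⟩ := h
    have : ⁅u + v, u - v⁆ = (((-2 : ℝ)) : ℂ) • ⁅u, v⁆ := by
      simp only [lie_sub, add_lie, lie_self]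
      rw [← lie_skew u v]
      push_cast
      module
    rw [this]
    exact aux_smul_mem p _ (hkp.lie_kp u hu v hv)
  · intro H hH
    rw [← lie_skew, leibniz_lie, hx.2 ⟨H, hH⟩, hy ⟨H, hH⟩, smul_lie, lie_smul]
    push_cast
    module

lemma AuxTh.form_lie (hkp : IsCartanDecomposition g k p) (ha : IsMaximalAbelianIn a p)
    {ξ : Module.Dual ℝ a} {x y : L} (h : AuxTh k p x y) (hx : x ∈ restrictedRootSpace g a ξ)
    (H : a) : auxB ⁅x, y⁆ H = ξ H * auxB x y := by
  rw [auxB_lie, ← lie_skew, h.neg_root hkp ha hx H, auxB_neg_right, auxB_smul_right]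
  ring

lemma AuxTh.comm (hkp : IsCartanDecomposition g k p) {x y x' y' : L} (h : AuxTh k p x y)
    (h' : AuxTh k p x' y') (hxx : ⁅x, x'⁆ = 0) : ⁅y, y'⁆ = 0 := by
  obtain ⟨u, hu, v, hv, rfl, rfl⟩ := h
  obtain ⟨u', hu', v', hv', rfl, rfl⟩ := h'
  have m3 : ⁅v, u'⁆ ∈ p := by
    rw [← lie_skew]; exact neg_mem (hkp.lie_kp u' hu' _ hv)
  obtain ⟨e1, e2⟩ := aux_split hkp (add_mem (hkp.lie_kk u hu u' hu') (hkp.lie_pp v hv v' hv'))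
    (zero_mem k) (add_mem (hkp.lie_kp u hu v' hv') m3) (zero_mem p)
    (by rw [add_zero, ← hxx]; simp only [lie_add, add_lie]; abel)
  have : ⁅u - v, u' - v'⁆ = (⁅u, u'⁆ + ⁅v, v'⁆) - (⁅u, v'⁆ + ⁅v, u'⁆) := by
    simp only [lie_sub, sub_lie]; abel
  rw [this, e1, e2, sub_zero]

lemma aux_a_eq (hkp : IsCartanDecomposition g k p) (ha : IsMaximalAbelianIn a p) {x y : L}
    (hx : x ∈ a) (hy : y ∈ a) (h : ∀ H : a, auxB x H = auxB y H) : x = y := by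
  by_contra hne
  have hpos : 0 < auxB (x - y) (x - y) :=
    hkp.killing_pos _ (ha.le (sub_mem hx hy)) (sub_ne_zero.2 hne)
  have h1 := h ⟨x - y, sub_mem hx hy⟩
  simp only at h1
  have h2 : auxB (x - y) (x - y) = auxB x (x - y) - auxB y (x - y) := by simp [auxB]
  linarith

/-- The vector of `a` dual to a restricted root. -/
lemma aux_dual (hkp : IsCartanDecomposition g k p) (ha : IsMaximalAbelianIn a p)
    {ξ : Module.Dual ℝ a} (hξ : ξ ∈ restrictedRoots g a) :
    ∃ A : a, (∀ H : a, auxB (A : L) H = ξ H) ∧ 0 < ξ A ∧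
      ∀ x y, AuxTh k p x y → x ∈ restrictedRootSpace g a ξ →
        ⁅x, y⁆ = ((auxB x y : ℝ) : ℂ) • (A : L) := by
  obtain ⟨hξ0, w, hw, hw0⟩ := hξ
  obtain ⟨z, hz⟩ := AuxTh.exists hkp hw.1
  have hq := hz.form_neg hkp hw0
  let A : a := ⟨(((auxB w z)⁻¹ : ℝ) : ℂ) • ⁅w, z⁆, aux_smul_mem a _ (hz.lie_mem hkp ha hw)⟩
  have hA : ∀ H : a, auxB (A : L) H = ξ H := by
    intro H
    simp only [A]
    rw [auxB_smul_left, hz.form_lie hkp ha hw]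
    have hq0 := hq.ne
    field_simp
  refine ⟨A, hA, ?_, ?_⟩
  · rw [← hA]
    apply hkp.killing_pos _ (ha.le A.2)
    intro hA0
    apply hξ0
    ext H
    rw [← hA, hA0]
    simp [auxB]
  · intro x y hxy hx
    apply aux_a_eq hkp ha (hxy.lie_mem hkp ha hx) (aux_smul_mem a _ A.2)
    intro H
    rw [hxy.form_lie hkp ha hx, auxB_smul_left, hA, mul_comm]

/-- Two restricted roots at an obtuse angle have a sum which is a root or zero. -/
lemma aux_add_root (hg : IsRealForm g) (hkp : IsCartanDecomposition g k p)
    (ha : IsMaximalAbelianIn a p) {ξ η : Module.Dual ℝ a} (hξ : ξ ∈ restrictedRoots g a)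
    (hη : η ∈ restrictedRoots g a) (A : a) (hA : ∀ H : a, auxB (A : L) H = ξ H)
    (hneg : η A < 0) (hne : ξ + η ≠ 0) : ξ + η ∈ restrictedRoots g a := by
  obtain ⟨A', hA', hpos, hlie⟩ := aux_dual hkp ha hξ
  obtain rfl : A = A' := Subtype.ext (aux_a_eq hkp ha A.2 A'.2 (fun H => by rw [hA, hA']))
  obtain ⟨hξ0, e, he, he0⟩ := hξ
  obtain ⟨hη0, v, hv, hv0⟩ := hη
  refine ⟨hne, ⁅e, v⁆, ⟨hg.lie_mem e he.1 v hv.1, ?_⟩, ?_⟩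
  · intro H
    rw [leibniz_lie, he.2 H, hv.2 H, smul_lie, lie_smul, ← add_smul]
    simp
  · intro hev
    obtain ⟨z, hz⟩ := AuxTh.exists hkp he.1
    have hq : auxB e z ≠ 0 := (hz.form_neg hkp he0).ne
    have hl : (ξ A : ℂ) ≠ 0 := by exact_mod_cast hpos.ne'
    have hqC : (auxB e z : ℂ) ≠ 0 := by exact_mod_cast hq
    have hA0 : (A : L) ≠ 0 := by
      intro h0
      have : ξ A = 0 := by rw [← hA, h0]; simp [auxB]
      exact hpos.ne' this
    have t : IsSl2Triple ((2 / (ξ A : ℂ)) • (A : L)) e ((2 / ((ξ A : ℂ) * auxB e z)) • z) := by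
      refine ⟨smul_ne_zero (div_ne_zero two_ne_zero hl) hA0, ?_, ?_, ?_⟩
      · rw [lie_smul, hlie e z hz he, smul_smul]
        congr 1
        field_simp
      · rw [smul_lie, he.2 A, smul_smul, div_mul_cancel₀ _ hl, two_smul, two_nsmul]
      · rw [smul_lie, lie_smul, hz.neg_root hkp ha he A, smul_smul, smul_smul, two_nsmul,
          ← add_smul, ← neg_smul]
        congr 1
        push_cast
        field_simp
        norm_num
    have P : t.HasPrimitiveVectorWith v (2 / (ξ A : ℂ) * (η A : ℂ)) :=
      ⟨hv0, by rw [smul_lie, hv.2 A, smul_smul], hev⟩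
    obtain ⟨n, hn⟩ := P.exists_nat
    have h1 : (2 / (ξ A) * (η A) : ℝ) = n := by exact_mod_cast hn
    have h2 : (2 / (ξ A) * (η A) : ℝ) < 0 := mul_neg_of_pos_of_neg (by positivity) hneg
    have h3 : (0 : ℝ) ≤ n := Nat.cast_nonneg n
    linarith

/-- A nonempty sum of positive restricted roots is non-zero. -/
lemma aux_pointed (hg : IsRealForm g) (hkp : IsCartanDecomposition g k p)
    (ha : IsMaximalAbelianIn a p) {P : Set (Module.Dual ℝ a)} (hP : IsPositiveSystem g a P)
    (n : ℕ) : ∀ (η : Module.Dual ℝ a) (s : Multiset (Module.Dual ℝ a)), η ∈ P →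
      (∀ ξ ∈ s, ξ ∈ P) → s.card = n → η + s.sum ≠ 0 := by
  induction n with
  | zero =>
    intro η s hη hs hn h0
    rw [Multiset.card_eq_zero] at hn
    subst hn
    exact (hP.subset hη).1 (by simpa using h0)
  | succ n ih =>
    intro η s hη hs hn h0
    obtain ⟨A, hA, hpos, -⟩ := aux_dual hkp ha (hP.subset hη)
    have hsum : s.sum A < 0 := by
      have := congrArg (fun φ : Module.Dual ℝ a => φ A) h0
      simp only [LinearMap.add_apply, LinearMap.zero_apply] at this
      linarith
    have hex : ∃ ξ ∈ s, ξ A < 0 := by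
      by_contra hcon
      push Not at hcon
      have : 0 ≤ (s.map (fun ξ : Module.Dual ℝ a => ξ A)).sum := by
        apply Multiset.sum_nonneg
        intro r hr
        obtain ⟨ξ, hξ, rfl⟩ := Multiset.mem_map.1 hr
        exact hcon ξ hξ
      have e : s.sum A = (s.map (fun ξ : Module.Dual ℝ a => ξ A)).sum := by
        have := map_multiset_sum (LinearMap.applyₗ (R := ℝ) (M₂ := ℝ) A) s
        simpa using this
      linarith
    obtain ⟨ξ, hξs, hξA⟩ := hex
    obtain ⟨s', rfl⟩ := Multiset.exists_cons_of_mem hξs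
    have hξP := hs ξ hξs
    have hne : η + ξ ≠ 0 := by
      intro h
      apply hP.not_both η hη
      rwa [neg_eq_of_add_eq_zero_right h]
    have hr := aux_add_root hg hkp ha (hP.subset hη) (hP.subset hξP) A hA hξA hne
    apply ih (η + ξ) s' (hP.add_mem η hη ξ hξP hr)
      (fun ζ hζ => hs ζ (Multiset.mem_cons_of_mem hζ)) (by simpa using hn)
    rw [Multiset.sum_cons] at h0
    rw [add_assoc, h0]

/-- Twice the highest restricted root is not a root, so `g_λ` is abelian. -/
lemma aux_comm (hg : IsRealForm g) (hkp : IsCartanDecomposition g k p)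
    (ha : IsMaximalAbelianIn a p) {P : Set (Module.Dual ℝ a)} (hP : IsPositiveSystem g a P)
    {lam : Module.Dual ℝ a} (hlam : IsHighestRestrictedRoot g a P lam) {x x' : L}
    (hx : x ∈ restrictedRootSpace g a lam) (hx' : x' ∈ restrictedRootSpace g a lam) :
    ⁅x, x'⁆ = 0 := by
  by_contra hne
  have h0 := (hP.subset hlam.1).1
  have hr : lam + lam ∈ restrictedRoots g a := by
    refine ⟨?_, ⁅x, x'⁆, ⟨hg.lie_mem x hx.1 x' hx'.1, ?_⟩, hne⟩
    · rw [← two_smul ℝ]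
      exact smul_ne_zero two_ne_zero h0
    · intro H
      rw [leibniz_lie, hx.2 H, hx'.2 H, smul_lie, lie_smul, ← add_smul]
      simp
  have h1 := hlam.2 _ hr
  obtain ⟨s, hs, hsum⟩ := AddSubmonoid.exists_multiset_of_mem_closure h1
  apply aux_pointed hg hkp ha hP s.card lam s hlam.1 hs rfl
  rw [hsum]
  abel

end Aux

/-- **Lemma 3.2 (Okuda).** Any two non-zero highest root vectors `X, X' ∈ g_lam` are
conjugate under `G_ℂ = Int(gC)`. -/
theorem highest_root_vectors_conjugate_under_GC
    {gC : Type*} [LieRing gC] [LieAlgebra ℂ gC] [FiniteDimensional ℂ gC]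
    [LieAlgebra.IsSimple ℂ gC]
    (g k p a : Submodule ℝ gC) (hg : IsRealForm g)
    (hkp : IsCartanDecomposition g k p) (hnoncompact : p ≠ ⊥)
    (ha : IsMaximalAbelianIn a p)
    (P : Set (Module.Dual ℝ a)) (hP : IsPositiveSystem g a P)
    (lam : Module.Dual ℝ a) (hlam : IsHighestRestrictedRoot g a P lam)
    (X X' : gC) (hX : X ∈ restrictedRootSpace g a lam) (hX0 : X ≠ 0)
    (hX' : X' ∈ restrictedRootSpace g a lam) (hX'0 : X' ≠ 0) :
    ∃ h ∈ innerAut (univ : Set gC), h X = X' := by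
  have hroot := hP.subset hlam.1
  obtain ⟨A, hA, hpos, hlie⟩ := aux_dual hkp ha hroot
  have hXX := aux_comm hg hkp ha hP hlam hX hX'
  obtain ⟨Y, hY⟩ := AuxTh.exists hkp hX.1
  obtain ⟨Y', hY'⟩ := AuxTh.exists hkp hX'.1
  have hq := hY.form_neg hkp hX0
  have hq' := hY'.form_neg hkp hX'0
  set q := auxB X Y with hqdef
  set q' := auxB X' Y' with hq'def
  set β := (auxB X Y' + auxB X' Y) / 2 with hβ
  set l := lam A with hl
  -- the root space is closed under real combinations
  have hcomb : ∀ t : ℝ, (t : ℂ) • X + X' ∈ restrictedRootSpace g a lam := by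
    intro t
    refine ⟨add_mem (aux_smul_mem g t hX.1) hX'.1, fun H => ?_⟩
    rw [lie_add, lie_smul, hX.2 H, hX'.2 H]
    module
  have hTh : ∀ t : ℝ, AuxTh k p ((t : ℂ) • X + X') ((t : ℂ) • Y + Y') :=
    fun t => (hY.smul t).add hY'
  have hqt : ∀ t : ℝ, auxB ((t : ℂ) • X + X') ((t : ℂ) • Y + Y') = t ^ 2 * q + 2 * t * β + q' := by
    intro t
    simp only [auxB_add_left, auxB_add_right, auxB_smul_left, auxB_smul_right]
    rw [hβ, hqdef, hq'def]; ring
  -- choose `t` with `t ^ 2 * q = q'` and `t * q + β ≠ 0`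
  obtain ⟨t, ht, htβ⟩ : ∃ t : ℝ, t ^ 2 * q = q' ∧ t * q + β ≠ 0 := by
    have hpos' : 0 < q' / q := div_pos_of_neg_of_neg hq' hq
    have hsq : Real.sqrt (q' / q) ^ 2 * q = q' := by
      rw [Real.sq_sqrt hpos'.le, div_mul_cancel₀ _ hq.ne]
    by_cases h : Real.sqrt (q' / q) * q + β = 0
    · refine ⟨-Real.sqrt (q' / q), by rw [neg_sq, hsq], ?_⟩
      have : Real.sqrt (q' / q) * q ≠ 0 := mul_ne_zero (Real.sqrt_pos.2 hpos').ne' hq.ne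
      intro h2
      apply this
      linarith
    · exact ⟨_, hsq, h⟩
  have ht0 : t ≠ 0 := by
    rintro rfl
    have : q' = 0 := by rw [← ht]; ring
    exact hq'.ne this
  set r := 2 * t * (t * q + β) with hr
  have hr0 : r ≠ 0 := mul_ne_zero (mul_ne_zero two_ne_zero ht0) htβ
  have hqZ : auxB ((t : ℂ) • X + X') ((t : ℂ) • Y + Y') = r := by
    rw [hqt, hr, ← ht]; ring
  -- brackets
  have b1 : ⁅X, Y⁆ = (q : ℂ) • (A : gC) := hlie X Y hY hX
  have b2 : ⁅X', Y'⁆ = (q' : ℂ) • (A : gC) := hlie X' Y' hY' hX'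
  have b3 : ⁅(t : ℂ) • X + X', (t : ℂ) • Y + Y'⁆ = (r : ℂ) • (A : gC) := by
    rw [hlie _ _ (hTh t) (hcomb t), hqZ]
  have b4 : ⁅X', Y⁆ = ((2 * β : ℝ) : ℂ) • (A : gC) - ⁅X, Y'⁆ := by
    have h1 := hlie _ _ (hTh 1) (hcomb 1)
    rw [hqt] at h1
    simp only [Complex.ofReal_one, one_smul, lie_add, add_lie, b1, b2] at h1
    rw [eq_sub_iff_add_eq]
    have h2 : ⁅X', Y⁆ + ⁅X, Y'⁆ = ((q : ℂ) • (A : gC) + ⁅X', Y⁆ + (⁅X, Y'⁆ + (q' : ℂ) • (A : gC)))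
        - (q : ℂ) • (A : gC) - (q' : ℂ) • (A : gC) := by abel
    rw [h2, h1]
    push_cast
    module
  have aX : ⁅(A : gC), X⁆ = (l : ℂ) • X := hX.2 A
  have aX' : ⁅(A : gC), X'⁆ = (l : ℂ) • X' := hX'.2 A
  have Xa : ⁅X, (A : gC)⁆ = -((l : ℂ) • X) := by rw [← lie_skew, aX]
  have Xa' : ⁅X', (A : gC)⁆ = -((l : ℂ) • X') := by rw [← lie_skew, aX']
  have aY := hY.neg_root hkp ha hX A
  have aZ := (hcomb t).2 A
  have aW := (hTh t).neg_root hkp ha (hcomb t) A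
  rw [← hl] at aY aZ aW
  have hXX' : ⁅X', X⁆ = 0 := by rw [← lie_skew, hXX, neg_zero]
  have c1 : ⁅X, ⁅X', Y⁆⁆ = -(((q * l : ℝ) : ℂ) • X') := by
    rw [leibniz_lie, hXX, zero_lie, zero_add, b1, lie_smul, Xa']
    push_cast; module
  have c2 : ⁅X', ⁅X', Y⁆⁆ = ((q' * l : ℝ) : ℂ) • X - ((2 * β * l : ℝ) : ℂ) • X' := by
    rw [b4, lie_sub, lie_smul, Xa', leibniz_lie X' X Y', hXX', zero_lie, zero_add, b2,
      lie_smul, Xa]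
    push_cast; module
  have key : ⁅(t : ℂ) • X + X', ⁅(t : ℂ) • X + X', Y⁆⁆
      = ((-2 * l * (t * q + β) : ℝ) : ℂ) • X' := by
    simp only [add_lie, smul_lie, lie_add, lie_smul, b1, c1, c2, Xa, Xa']
    rw [← ht]
    push_cast
    module
  -- complex scaling
  obtain ⟨s, hs⟩ := IsAlgClosed.exists_pow_nat_eq ((q / (2 * (t * q + β)) : ℝ) : ℂ)
    (n := 2) two_pos
  have hlC : (l : ℂ) ≠ 0 := by exact_mod_cast hpos.ne'
  have hqC : (q : ℂ) ≠ 0 := by exact_mod_cast hq.ne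
  have hrC : (r : ℂ) ≠ 0 := by exact_mod_cast hr0
  have htC : (t : ℂ) * q + β ≠ 0 := by exact_mod_cast htβ
  have hs0 : s ≠ 0 := by
    rintro rfl
    have h1 : ((q / (2 * (t * q + β)) : ℝ) : ℂ) ≠ 0 := by
      push_cast
      exact div_ne_zero hqC (mul_ne_zero two_ne_zero htC)
    apply h1
    rw [← hs]; norm_num
  refine aux_conj ((2 / (l : ℂ)) • (A : gC)) X ((2 / ((l : ℂ) * q)) • Y)
    (s • ((t : ℂ) • X + X')) ((2 / (s * l * r)) • ((t : ℂ) • Y + Y')) X' ?_ ?_ ?_ ?_ ?_ ?_ ?_ ?_ ?_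
  · rw [lie_smul, b1, smul_smul]; congr 1; field_simp
  · rw [smul_lie, aX, smul_smul]; congr 1; field_simp
  · rw [smul_lie, lie_smul, aY, smul_smul, smul_smul, smul_smul]
    congr 1; push_cast; field_simp
  · rw [lie_smul, smul_lie, b3, smul_smul, smul_smul]; congr 1; field_simp
  · rw [smul_lie, lie_smul, aZ, smul_smul, smul_smul, smul_smul]; congr 1; field_simp
  · rw [smul_lie, lie_smul, aW, smul_smul, smul_smul, smul_smul]
    congr 1; push_cast; field_simp
  · have hYY : ⁅Y', Y⁆ = 0 := hY'.comm hkp hY hXX'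
    rw [smul_lie, lie_smul, add_lie, smul_lie, lie_self, hYY]
    simp
  · rw [lie_smul, smul_lie, lie_smul, smul_lie, lie_smul, key, smul_smul, smul_smul, smul_smul]
    congr 1
    have hs' : s * s = q / (2 * (t * q + β)) := by
      rw [← sq, hs]; push_cast; rfl
    have e1 : ∀ c d : ℂ, s * c * s * d = (s * s) * (c * d) := by intros; ring
    rw [e1, hs']
    push_cast
    generalize (t : ℂ) * q + β = c at htC
    field_simp
  · rw [smul_lie, add_lie, smul_lie, hXX, lie_self]
    simp

end SmallestOrbitPaper
end

section
/- Let g be a non-compact real simple Lie algebra without complex structure, τ the conjugation of g_C with respect to g, A_λ ∈ a the coroot of the highest restricted root λ, and H_φ ∈ h the coroot of the highest root φ of Δ+(g_C,h_C). Then A_λ = H_φ if dim_R g_λ = 1, and A_λ = H_φ + τ(H_φ) if dim_R g_λ ≥ 2. -/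
/-!
Common definitions: a complex simple Lie algebra `gC`, real forms, Cartan decompositions,
restricted roots, inner automorphism groups, adjoint orbits and the closure ordering.
-/

open LieAlgebra Set

namespace SmallestOrbitPaper

variable {gC : Type*} [LieRing gC] [LieAlgebra ℂ gC]

section Helpers

local notation "κ" => killingForm ℂ gC

/-- Pointedness of a positive system, abstractly. -/
lemma pointed_list {M : Type*} [AddCommGroup M] (P : Set M)
    (h0 : ∀ ξ ∈ P, ∃ f : M →+ ℝ, 0 < f ξ ∧ ∀ η ∈ P, f η < 0 → ξ + η ∈ P) :
    ∀ (n : ℕ) (l : List M), l.length = n → l ≠ [] → (∀ x ∈ l, x ∈ P) → l.sum ≠ 0 := by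
  classical
  intro n
  induction n with
  | zero => intro l hl hne; exact absurd (List.length_eq_zero_iff.mp hl) hne
  | succ n ih =>
    intro l hl hne hP hs
    obtain ⟨ξ, l', rfl⟩ := List.exists_cons_of_ne_nil hne
    obtain ⟨f, hf, hf'⟩ := h0 ξ (hP ξ (by simp))
    have h1 : ∃ η ∈ l', f η < 0 := by
      by_contra hcon
      push Not at hcon
      have h2 : 0 ≤ (l'.map f).sum := by
        apply List.sum_nonneg
        intro x hx
        obtain ⟨y, hy, rfl⟩ := List.mem_map.mp hx
        exact hcon y hy
      have h3 : f (ξ :: l').sum = 0 := by rw [hs]; simp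
      rw [List.sum_cons, map_add, map_list_sum] at h3
      linarith
    obtain ⟨η, hη, hfη⟩ := h1
    have h2 := hf' η (hP η (by simp [hη])) hfη
    have h3 : (l'.erase η).length + 1 = l'.length := List.length_erase_add_one hη
    refine ih ((ξ + η) :: l'.erase η) ?_ (by simp) ?_ ?_
    · simp at hl ⊢; omega
    · intro x hx
      rcases List.mem_cons.mp hx with rfl | hx
      · exact h2
      · exact hP x (by simp [List.mem_of_mem_erase hx])
    · have h4 := (List.perm_cons_erase hη).sum_eq
      rw [List.sum_cons] at hs h4 ⊢
      rw [← hs, h4, add_assoc]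

lemma pointed {M : Type*} [AddCommGroup M] (P : Set M)
    (h0 : ∀ ξ ∈ P, ∃ f : M →+ ℝ, 0 < f ξ ∧ ∀ η ∈ P, f η < 0 → ξ + η ∈ P)
    (x : M) (hx : x ∈ AddSubmonoid.closure P) (hx' : -x ∈ AddSubmonoid.closure P) : x = 0 := by
  obtain ⟨l, hl, rfl⟩ := AddSubmonoid.exists_list_of_mem_closure hx
  obtain ⟨l', hl', h'⟩ := AddSubmonoid.exists_list_of_mem_closure hx'
  by_contra hne
  have hl0 : l ≠ [] := by rintro rfl; simp at hne
  refine pointed_list P h0 _ (l ++ l') rfl (by simp [hl0]) ?_ (by simp [h'])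
  intro x hx
  rcases List.mem_append.mp hx with h | h
  exacts [hl x h, hl' x h]

lemma kil_comm (x y : gC) : κ x y = κ y x := LieModule.traceForm_comm ℂ gC gC x y

lemma kil_lie (x y z : gC) : κ ⁅x, y⁆ z = κ x ⁅y, z⁆ :=
  LieModule.traceForm_apply_lie_apply ℂ gC gC x y z

/-- A conjugation preserves the Killing form up to complex conjugation. -/
lemma kil_conj [FiniteDimensional ℂ gC] (τ : gC →ₗ[ℝ] gC)
    (hτinv : ∀ x, τ (τ x) = x)
    (hτconj : ∀ (c : ℂ) (x : gC), τ (c • x) = (starRingEnd ℂ) c • τ x)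
    (hτlie : ∀ x y : gC, τ ⁅x, y⁆ = ⁅τ x, τ y⁆) (x y : gC) :
    κ (τ x) (τ y) = (starRingEnd ℂ) (κ x y) := by
  let b := Module.finBasis ℂ gC
  let e : gC ≃ₗ[ℂ] (Fin (Module.finrank ℂ gC) → ℂ) :=
    { toFun := fun z i => (starRingEnd ℂ) (b.equivFun (τ z) i)
      map_add' := by intro u v; ext i; simp
      map_smul' := by intro c u; ext i; simp [hτconj]
      invFun := fun v => τ (b.equivFun.symm fun i => (starRingEnd ℂ) (v i))
      left_inv := by intro z; simp [hτinv]
      right_inv := by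
        intro v; ext i
        simp only [hτinv, LinearEquiv.apply_symm_apply, Complex.conj_conj] }
  have he : ∀ z i, e z i = (starRingEnd ℂ) (b.repr (τ z) i) := fun z i => rfl
  let b' := Module.Basis.ofEquivFun e
  have hb' : ∀ i, b' i = τ (b i) := by
    intro i
    have h1 : b' i = e.symm (Pi.single i 1) := by
      simp only [b', Module.Basis.coe_ofEquivFun]
    rw [h1, LinearEquiv.symm_apply_eq]
    ext j
    rw [he, hτinv, Module.Basis.repr_self, Finsupp.single_apply, Pi.single_apply]
    by_cases h : j = i
    · subst h; simp
    · simp [h, Ne.symm h]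
  have hr : ∀ z i, b'.repr z i = (starRingEnd ℂ) (b.repr (τ z) i) := by
    intro z i
    rw [← he z i]
    change (Module.Basis.ofEquivFun e).equivFun z i = _
    rw [Module.Basis.equivFun_ofEquivFun]
  rw [killingForm_apply_apply, killingForm_apply_apply, LinearMap.trace_eq_matrix_trace ℂ b',
    LinearMap.trace_eq_matrix_trace ℂ b, Matrix.trace, Matrix.trace, map_sum]
  refine Finset.sum_congr rfl fun i _ => ?_
  simp only [Matrix.diag_apply, LinearMap.toMatrix_apply, hr, hb']
  simp [hτlie, hτinv]

/-- Every real form has a conjugation. -/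
lemma exists_conj (U : Submodule ℝ gC) (hU : IsRealForm U) :
    ∃ η : gC →ₗ[ℝ] gC, (∀ x, η (η x) = x) ∧
      (∀ (c : ℂ) (x : gC), η (c • x) = (starRingEnd ℂ) c • η x) ∧
      (∀ x ∈ U, η x = x) ∧ (∀ x y : gC, η ⁅x, y⁆ = ⁅η x, η y⁆) := by
  choose u hu v hv huv using hU.spans
  have huniq : ∀ a ∈ U, ∀ b ∈ U, ∀ c ∈ U, ∀ d ∈ U,
      a + Complex.I • b = c + Complex.I • d → a = c ∧ b = d := by
    intro a ha b hb c hc d hd h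
    have h1 : Complex.I • (b - d) = c - a := by
      rw [smul_sub, sub_eq_sub_iff_add_eq_add, add_comm, h, add_comm]
    have h2 : b - d = 0 := hU.indep _ (U.sub_mem hb hd) (h1 ▸ U.sub_mem hc ha)
    rw [h2, smul_zero] at h1
    exact ⟨(sub_eq_zero.mp h1.symm).symm, sub_eq_zero.mp h2⟩
  have key : ∀ z, ∀ a ∈ U, ∀ b ∈ U, z = a + Complex.I • b → u z = a ∧ v z = b := by
    intro z a ha b hb h
    exact huniq _ (hu z) _ (hv z) _ ha _ hb ((huv z).symm.trans h)
  let η : gC →ₗ[ℝ] gC :=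
    { toFun := fun z => u z - Complex.I • v z
      map_add' := by
        intro x y
        obtain ⟨h1, h2⟩ := key (x + y) (u x + u y) (U.add_mem (hu x) (hu y)) (v x + v y)
          (U.add_mem (hv x) (hv y)) (by
            conv_lhs => rw [huv x, huv y]
            rw [smul_add]; abel)
        rw [h1, h2, smul_add]; abel
      map_smul' := by
        intro r x
        obtain ⟨h1, h2⟩ := key (r • x) (r • u x) (U.smul_mem r (hu x)) (r • v x)
          (U.smul_mem r (hv x)) (by
            conv_lhs => rw [huv x]
            rw [smul_add, smul_comm r Complex.I])
        simp only [h1, h2, RingHom.id_apply, smul_sub]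
        rw [smul_comm r Complex.I] }
  have hη : ∀ a ∈ U, ∀ b ∈ U, η (a + Complex.I • b) = a - Complex.I • b := by
    intro a ha b hb
    obtain ⟨h1, h2⟩ := key _ a ha b hb rfl
    change u _ - Complex.I • v _ = _
    rw [h1, h2]
  have hηI : ∀ x, η (Complex.I • x) = -(Complex.I • η x) := by
    intro x
    have e1 : Complex.I • x = -(v x) + Complex.I • u x := by
      conv_lhs => rw [huv x]
      rw [smul_add, smul_smul, Complex.I_mul_I, neg_one_smul, add_comm]
    rw [e1, hη _ (U.neg_mem (hv x)) _ (hu x)]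
    conv_rhs => rw [huv x, hη _ (hu x) _ (hv x)]
    rw [smul_sub, smul_smul, Complex.I_mul_I, neg_one_smul]; abel
  have hconj : ∀ (c : ℂ) (x : gC), η (c • x) = (starRingEnd ℂ) c • η x := by
    intro c x
    have e1 : c • x = c.re • x + c.im • (Complex.I • x) := by
      conv_lhs => rw [← Complex.re_add_im c]
      rw [add_smul, mul_smul]; rfl
    rw [e1, map_add, map_smul, map_smul, hηI]
    have e2 : (starRingEnd ℂ) c = (c.re : ℂ) - (c.im : ℂ) * Complex.I := by
      apply Complex.ext <;> simp
    rw [e2, sub_smul, mul_smul, smul_neg, ← sub_eq_add_neg]; rfl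
  have hfix : ∀ x ∈ U, η x = x := by
    intro x hx
    have := hη x hx 0 U.zero_mem
    simpa using this
  refine ⟨η, ?_, hconj, hfix, ?_⟩
  · intro x
    conv_lhs => rw [huv x, hη _ (hu x) _ (hv x), map_sub, hηI, hfix _ (hu x), hfix _ (hv x)]
    rw [sub_neg_eq_add, ← huv x]
  · intro x y
    have hl : ∀ x ∈ U, ∀ y ∈ U, η ⁅x, y⁆ = ⁅x, y⁆ := fun x hx y hy =>
      hfix _ (hU.lie_mem x hx y hy)
    conv_lhs => rw [huv x, huv y]
    conv_rhs => rw [huv x, huv y]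
    simp only [hη _ (hu _) _ (hv _), lie_add, add_lie, lie_sub, sub_lie, smul_lie, lie_smul,
      map_add, hηI, hl _ (hu _) _ (hu _), hl _ (hu _) _ (hv _), hl _ (hv _) _ (hu _),
      hl _ (hv _) _ (hv _)]
    abel_nf

/-- The package of properties of the conjugation with respect to a compact real form. -/
structure CConj (η : gC →ₗ[ℝ] gC) : Prop where
  inv : ∀ x, η (η x) = x
  conj : ∀ (c : ℂ) (x : gC), η (c • x) = (starRingEnd ℂ) c • η x
  lie : ∀ x y : gC, η ⁅x, y⁆ = ⁅η x, η y⁆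
  kil : ∀ x y : gC, κ (η x) (η y) = (starRingEnd ℂ) (κ x y)
  neg : ∀ x : gC, x ≠ 0 → (κ x (η x)).re < 0

lemma CConj.im {η : gC →ₗ[ℝ] gC} (h : CConj η) (x : gC) : (κ x (η x)).im = 0 := by
  have h1 := h.kil x (η x)
  rw [h.inv, kil_comm] at h1
  have h2 := congrArg Complex.im h1
  simp at h2
  linarith

lemma CConj.ne {η : gC →ₗ[ℝ] gC} (h : CConj η) {x : gC} (hx : x ≠ 0) : κ x (η x) ≠ 0 := by
  intro h0
  have := h.neg x hx
  rw [h0] at this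
  simp at this

lemma CConj.real {η : gC →ₗ[ℝ] gC} (h : CConj η) (x : gC) :
    κ x (η x) = (((κ x (η x)).re : ℝ) : ℂ) := by
  apply Complex.ext <;> simp [h.im]

lemma CConj.np {η : gC →ₗ[ℝ] gC} (h : CConj η) (x : gC) : (κ x (η x)).re ≤ 0 := by
  by_cases hx : x = 0
  · simp [hx]
  · exact (h.neg x hx).le

lemma CConj.eta_ne {η : gC →ₗ[ℝ] gC} (h : CConj η) {x : gC} (hx : x ≠ 0) : η x ≠ 0 := by
  intro h0
  apply hx
  rw [← h.inv x, h0, map_zero]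

lemma CConj.eta_W {η : gC →ₗ[ℝ] gC} (h : CConj η) (x : gC) : η ⁅x, η x⁆ = -⁅x, η x⁆ := by
  rw [h.lie, h.inv, lie_skew]

/-- The norm identity. -/
lemma CConj.normid {η : gC →ₗ[ℝ] gC} (h : CConj η) (x y : gC) (hxy : ⁅x, y⁆ = 0) :
    κ ⁅⁅x, η x⁆, y⁆ (η y) = - κ ⁅η x, y⁆ (η ⁅η x, y⁆) := by
  have e1 : ⁅⁅x, η x⁆, y⁆ = ⁅x, ⁅η x, y⁆⁆ := by
    rw [lie_lie, hxy, lie_zero, sub_zero]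
  rw [e1, h.lie, h.inv, ← lie_skew, map_neg, LinearMap.neg_apply, kil_lie]

lemma CConj.T1 {η : gC →ₗ[ℝ] gC} (h : CConj η) (x : gC) (hW : ⁅x, η x⁆ ≠ 0) (hx : x ≠ 0) (c : ℂ)
    (hc : ⁅⁅x, η x⁆, x⁆ = c • x) : c.re < 0 := by
  have h1 : c * κ x (η x) = - κ ⁅x, η x⁆ (η ⁅x, η x⁆) := by
    rw [h.eta_W, map_neg, neg_neg, ← kil_lie, hc]; simp
  have h2 := h.neg _ hW
  have h3 := h.neg x hx
  have h4 := congrArg Complex.re h1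
  rw [h.real x, Complex.re_mul_ofReal, Complex.neg_re] at h4
  nlinarith

lemma CConj.T2 {η : gC →ₗ[ℝ] gC} (h : CConj η) (x y : gC) (hxy : ⁅x, y⁆ = 0) (hy : y ≠ 0) (d : ℂ)
    (hd : ⁅⁅x, η x⁆, y⁆ = d • y) : d.re ≤ 0 := by
  have h1 := h.normid x y hxy
  rw [hd, map_smul, LinearMap.smul_apply, smul_eq_mul] at h1
  have h2 := h.np ⁅η x, y⁆
  have h3 := h.neg y hy
  have h4 := congrArg Complex.re h1
  rw [h.real y, Complex.re_mul_ofReal, Complex.neg_re] at h4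
  nlinarith

lemma compact_realForm (g k p : Submodule ℝ gC) (hg : IsRealForm g)
    (hkp : IsCartanDecomposition g k p) :
    IsRealForm (k ⊔ p.map ((Complex.I • (LinearMap.id : gC →ₗ[ℂ] gC)).restrictScalars ℝ)) := by
  have hmem : ∀ x : gC,
      x ∈ k ⊔ p.map ((Complex.I • (LinearMap.id : gC →ₗ[ℂ] gC)).restrictScalars ℝ) ↔
      ∃ y ∈ k, ∃ z ∈ p, x = y + Complex.I • z := by
    intro x
    rw [Submodule.mem_sup]
    constructor
    · rintro ⟨y, hy, w, ⟨z, hz, rfl⟩, rfl⟩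
      exact ⟨y, hy, z, hz, rfl⟩
    · rintro ⟨y, hy, z, hz, rfl⟩
      exact ⟨y, hy, _, ⟨z, hz, rfl⟩, rfl⟩
  have hdec : ∀ x ∈ g, ∃ y ∈ k, ∃ z ∈ p, x = y + z := by
    intro x hx
    rw [← hkp.sup_eq, Submodule.mem_sup] at hx
    obtain ⟨y, hy, z, hz, rfl⟩ := hx
    exact ⟨y, hy, z, hz, rfl⟩
  have hbot : ∀ x ∈ k, x ∈ p → x = 0 := by
    intro x h1 h2
    have : x ∈ k ⊓ p := ⟨h1, h2⟩
    rw [hkp.inf_eq] at this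
    exact this
  refine ⟨?_, ?_, ?_⟩
  · intro x hx y hy
    rw [hmem] at hx hy ⊢
    obtain ⟨x1, hx1, x2, hx2, rfl⟩ := hx
    obtain ⟨y1, hy1, y2, hy2, rfl⟩ := hy
    refine ⟨⁅x1, y1⁆ - ⁅x2, y2⁆, k.sub_mem (hkp.lie_kk _ hx1 _ hy1) (hkp.lie_pp _ hx2 _ hy2),
      ⁅x1, y2⁆ - ⁅y1, x2⁆, p.sub_mem (hkp.lie_kp _ hx1 _ hy2) (hkp.lie_kp _ hy1 _ hx2), ?_⟩
    rw [← lie_skew y1 x2]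
    simp only [lie_add, add_lie, smul_lie, lie_smul, smul_smul, Complex.I_mul_I, smul_sub,
      smul_add, smul_neg, neg_smul, one_smul]
    abel
  · intro z
    obtain ⟨x, hx, y, hy, rfl⟩ := hg.spans z
    obtain ⟨x1, hx1, x2, hx2, rfl⟩ := hdec x hx
    obtain ⟨y1, hy1, y2, hy2, rfl⟩ := hdec y hy
    refine ⟨x1 + Complex.I • y2, (hmem _).2 ⟨x1, hx1, y2, hy2, rfl⟩,
      y1 + Complex.I • (-x2), (hmem _).2 ⟨y1, hy1, -x2, p.neg_mem hx2, rfl⟩, ?_⟩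
    simp only [smul_add, smul_smul, Complex.I_mul_I, neg_smul, one_smul, neg_neg]
    abel
  · intro x hx hx'
    rw [hmem] at hx hx'
    obtain ⟨x1, hx1, x2, hx2, rfl⟩ := hx
    obtain ⟨y1, hy1, y2, hy2, h⟩ := hx'
    rw [smul_add, smul_smul, Complex.I_mul_I, neg_smul, one_smul] at h
    have h1 : Complex.I • (x1 - y2) = y1 + x2 := by
      rw [smul_sub, sub_eq_iff_eq_add]
      rw [← sub_eq_add_neg, sub_eq_iff_eq_add] at h
      rw [h]; abel
    have h2 : x1 - y2 = 0 := hg.indep _ (g.sub_mem (hkp.k_le hx1) (hkp.p_le hy2))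
      (h1 ▸ g.add_mem (hkp.k_le hy1) (hkp.p_le hx2))
    rw [h2, smul_zero] at h1
    have h3 : x1 = 0 := hbot _ hx1 (sub_eq_zero.mp h2 ▸ hy2)
    have h4 : x2 = 0 := by
      refine hbot _ ?_ hx2
      rw [eq_neg_of_add_eq_zero_right h1.symm]
      exact k.neg_mem hy1
    simp [h3, h4]

lemma exists_cconj [FiniteDimensional ℂ gC] (g k p : Submodule ℝ gC) (hg : IsRealForm g)
    (hkp : IsCartanDecomposition g k p) (τ : gC →ₗ[ℝ] gC)
    (hτinv : ∀ x, τ (τ x) = x)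
    (hτconj : ∀ (c : ℂ) (x : gC), τ (c • x) = (starRingEnd ℂ) c • τ x)
    (hτfix : ∀ x : gC, τ x = x ↔ x ∈ g)
    (hτlie : ∀ x y : gC, τ ⁅x, y⁆ = ⁅τ x, τ y⁆) :
    ∃ η : gC →ₗ[ℝ] gC, CConj η ∧ (∀ x ∈ k, η x = x) ∧ (∀ x ∈ p, η x = -x) ∧
      (∀ x, τ (η x) = η (τ x)) := by
  obtain ⟨η, hinv, hconj, hfix, hlie⟩ := exists_conj _ (compact_realForm g k p hg hkp)
  have hk : ∀ x ∈ k, η x = x := fun x hx => hfix x (Submodule.mem_sup_left hx)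
  have hp : ∀ x ∈ p, η x = -x := by
    intro x hx
    have h1 : η (Complex.I • x) = Complex.I • x :=
      hfix _ (Submodule.mem_sup_right ⟨x, hx, rfl⟩)
    rw [hconj, Complex.conj_I, neg_smul, ← smul_neg] at h1
    have h2 := smul_right_injective gC Complex.I_ne_zero h1
    exact neg_eq_iff_eq_neg.mp h2
  have hτk : ∀ x ∈ k, τ x = x := fun x hx => (hτfix x).2 (hkp.k_le hx)
  have hτp : ∀ x ∈ p, τ x = x := fun x hx => (hτfix x).2 (hkp.p_le hx)
  have hdec : ∀ z : gC, ∃ a ∈ k, ∃ b ∈ p, ∃ c ∈ k, ∃ d ∈ p,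
      z = (a + b) + Complex.I • (c + d) := by
    intro z
    obtain ⟨x, hx, y, hy, rfl⟩ := hg.spans z
    rw [← hkp.sup_eq, Submodule.mem_sup] at hx hy
    obtain ⟨y0, hy0, z0, hz0, rfl⟩ := hx
    obtain ⟨y', hy', z', hz', rfl⟩ := hy
    exact ⟨y0, hy0, z0, hz0, y', hy', z', hz', rfl⟩
  have hkil := kil_conj η hinv hconj hlie
  have hτkil := kil_conj τ hτinv hτconj hτlie
  have hkp0 : ∀ x ∈ k, ∀ y ∈ p, κ x y = 0 := by
    intro x hx y hy
    have h1 := hkil x y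
    have h2 := hτkil x y
    rw [hk x hx, hp y hy, map_neg] at h1
    rw [hτk x hx, hτp y hy] at h2
    rw [← h2] at h1
    exact CharZero.neg_eq_self_iff.mp h1
  refine ⟨η, ⟨hinv, hconj, hlie, hkil, ?_⟩, hk, hp, ?_⟩
  · intro x hx
    obtain ⟨a, ha, b, hb, c, hc, d, hd, rfl⟩ := hdec x
    have e : κ ((a + b) + Complex.I • (c + d)) (η ((a + b) + Complex.I • (c + d))) =
        κ a a - κ b b + κ c c - κ d d := by
      simp only [map_add, hconj, hk a ha, hk c hc, hp b hb, hp d hd, Complex.conj_I,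
        LinearMap.add_apply, map_smul, LinearMap.smul_apply, smul_eq_mul, map_neg,
        hkp0 a ha b hb, hkp0 a ha d hd, hkp0 c hc b hb, hkp0 c hc d hd,
        kil_comm b a, kil_comm b c, kil_comm d a, kil_comm d c, kil_comm c a, kil_comm d b]
      linear_combination (-κ c c + κ d d) * Complex.I_mul_I
    rw [e]
    have hk' : ∀ x ∈ k, (κ x x).re ≤ 0 := by
      intro x hx
      by_cases h : x = 0
      · simp [h]
      · exact (hkp.killing_neg x hx h).le
    have hp' : ∀ x ∈ p, 0 ≤ (κ x x).re := by
      intro x hx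
      by_cases h : x = 0
      · simp [h]
      · exact (hkp.killing_pos x hx h).le
    simp only [Complex.add_re, Complex.sub_re]
    have h1 := hk' a ha
    have h2 := hp' b hb
    have h3 := hk' c hc
    have h4 := hp' d hd
    by_contra hcon
    have ha0 : a = 0 := by
      by_contra h
      have := hkp.killing_neg a ha h
      linarith
    have hb0 : b = 0 := by
      by_contra h
      have := hkp.killing_pos b hb h
      linarith
    have hc0 : c = 0 := by
      by_contra h
      have := hkp.killing_neg c hc h
      linarith
    have hd0 : d = 0 := by
      by_contra h
      have := hkp.killing_pos d hd h
      linarith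
    apply hx
    simp [ha0, hb0, hc0, hd0]
  · intro x
    obtain ⟨a, ha, b, hb, c, hc, d, hd, rfl⟩ := hdec x
    simp only [map_add, hconj, hτconj, hk a ha, hk c hc, hp b hb, hp d hd,
      hτk a ha, hτk c hc, hτp b hb, hτp d hd, map_neg]

lemma CConj.isKilling [FiniteDimensional ℂ gC] {η : gC →ₗ[ℝ] gC} (h : CConj η) :
    LieAlgebra.IsKilling ℂ gC := by
  constructor
  rw [LieSubmodule.eq_bot_iff]
  intro x hx
  by_contra hne
  rw [LieIdeal.mem_killingCompl] at hx
  have := hx (η x) (by simp)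
  rw [kil_comm] at this
  exact h.ne hne this

/-- Existence of a simultaneous eigenvector in an invariant subspace. -/
lemma exists_eigenvector [FiniteDimensional ℂ gC] (hC : LieSubalgebra ℂ gC) [IsLieAbelian hC]
    (V : Submodule ℂ gC) (hV : V ≠ ⊥) (hinv : ∀ H ∈ hC, ∀ x ∈ V, ⁅H, x⁆ ∈ V) :
    ∃ x ∈ V, x ≠ 0 ∧ ∃ χ : Module.Dual ℂ hC, ∀ H : hC, ⁅(H : gC), x⁆ = χ H • x := by
  let N : LieSubmodule ℂ hC gC := { V with lie_mem := fun {H x} hx => hinv H H.2 x hx }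
  have hN : Nontrivial N := by
    obtain ⟨x, hx, hx0⟩ := Submodule.exists_mem_ne_zero_of_ne_bot hV
    exact ⟨⟨x, hx⟩, 0, fun h => hx0 (congrArg Subtype.val h)⟩
  obtain ⟨χ, hχ⟩ := LieModule.exists_nontrivial_weightSpace_of_isSolvable ℂ hC N
  obtain ⟨⟨⟨x, hx⟩, hx'⟩, hne⟩ := exists_ne (0 : LieModule.weightSpace N χ)
  rw [LieModule.mem_weightSpace] at hx'
  refine ⟨x, hx, ?_, χ, fun H => ?_⟩
  · rintro rfl
    exact hne rfl
  · exact congrArg Subtype.val (hx' H)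

lemma wt_add {H x y : gC} {c d : ℂ} (hx : ⁅H, x⁆ = c • x) (hy : ⁅H, y⁆ = d • y) :
    ⁅H, ⁅x, y⁆⁆ = (c + d) • ⁅x, y⁆ := by
  rw [leibniz_lie, hx, hy, smul_lie, lie_smul, add_smul]

lemma CConj.nondeg {η : gC →ₗ[ℝ] gC} (h : CConj η) (hC : LieSubalgebra ℂ gC)
    (hηh : ∀ H ∈ hC, η H ∈ hC) (D : gC) (hD : D ∈ hC) (hD' : ∀ H ∈ hC, κ D H = 0) : D = 0 := by
  by_contra hne
  exact h.ne hne (hD' _ (hηh D hD))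

lemma CConj.wt_eta {η : gC →ₗ[ℝ] gC} (h : CConj η) (hC : LieSubalgebra ℂ gC)
    (hηh : ∀ H ∈ hC, η H ∈ hC) (χ : Module.Dual ℂ hC) (x : gC) (hx0 : x ≠ 0)
    (hx : ∀ H : hC, ⁅(H : gC), x⁆ = χ H • x) (H : hC) : ⁅(H : gC), η x⁆ = (-χ H) • η x := by
  have h1 : ⁅(H : gC), η x⁆ = (starRingEnd ℂ) (χ ⟨η H, hηh H H.2⟩) • η x := by
    rw [← h.conj, ← hx, h.lie, h.inv]
  have h2 : κ ⁅(H : gC), x⁆ (η x) = - κ x ⁅(H : gC), η x⁆ := by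
    rw [← lie_skew, map_neg, LinearMap.neg_apply, kil_lie]
  rw [h1, hx, map_smul, map_smul, LinearMap.smul_apply, smul_eq_mul, smul_eq_mul, ← neg_mul] at h2
  have h3 := mul_right_cancel₀ (h.ne hx0) h2
  rw [h1, h3, neg_neg]

lemma cartan_cent (hC : LieSubalgebra ℂ gC) [hC.IsCartanSubalgebra] (x : gC)
    (hx : ∀ H : hC, ⁅(H : gC), x⁆ = 0) : x ∈ hC := by
  rw [← LieSubalgebra.IsCartanSubalgebra.self_normalizing (H := hC),
    LieSubalgebra.mem_normalizer_iff]
  intro y hy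
  rw [← lie_skew, hx ⟨y, hy⟩, neg_zero]
  exact hC.zero_mem

lemma CConj.W_mem {η : gC →ₗ[ℝ] gC} (h : CConj η) (hC : LieSubalgebra ℂ gC)
    [hC.IsCartanSubalgebra]
    (hηh : ∀ H ∈ hC, η H ∈ hC) (χ : Module.Dual ℂ hC) (x : gC) (hx0 : x ≠ 0)
    (hx : ∀ H : hC, ⁅(H : gC), x⁆ = χ H • x) : ⁅x, η x⁆ ∈ hC := by
  refine cartan_cent hC _ fun H => ?_
  rw [wt_add (hx H) (h.wt_eta hC hηh χ x hx0 hx H), add_neg_cancel, zero_smul]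

lemma CConj.W_kil {η : gC →ₗ[ℝ] gC} (h : CConj η) (hC : LieSubalgebra ℂ gC)
    (hηh : ∀ H ∈ hC, η H ∈ hC) (χ : Module.Dual ℂ hC) (x : gC) (hx0 : x ≠ 0)
    (hx : ∀ H : hC, ⁅(H : gC), x⁆ = χ H • x) (H : hC) :
    κ ⁅x, η x⁆ H = χ H * κ x (η x) := by
  rw [kil_lie, ← lie_skew, h.wt_eta hC hηh χ x hx0 hx H]
  simp

/-- `PC` is pointed. -/
lemma CConj.pointedC {η : gC →ₗ[ℝ] gC} (h : CConj η) (hC : LieSubalgebra ℂ gC)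
    [hC.IsCartanSubalgebra]
    (hηh : ∀ H ∈ hC, η H ∈ hC) (PC : Set (Module.Dual ℂ hC)) (hPC : IsPositiveSystemC hC PC)
    (ψ : Module.Dual ℂ hC) (h1 : ψ ∈ AddSubmonoid.closure PC)
    (h2 : -ψ ∈ AddSubmonoid.closure PC) : ψ = 0 := by
  refine pointed PC ?_ ψ h1 h2
  intro χ hχ
  obtain ⟨hχ0, x, hx, hx0⟩ := hPC.subset hχ
  have hW := h.W_mem hC hηh χ x hx0 hx
  let f : Module.Dual ℂ hC →+ ℝ :=
    { toFun := fun ψ => -(ψ ⟨⁅x, η x⁆, hW⟩).re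
      map_zero' := by simp
      map_add' := by intro u v; simp; ring }
  have hWne : ⁅x, η x⁆ ≠ 0 := by
    intro h0
    apply hχ0
    ext H
    have h3 := h.W_kil hC hηh χ x hx0 hx H
    rw [h0, map_zero, LinearMap.zero_apply] at h3
    simpa [h.ne hx0] using h3.symm
  refine ⟨f, ?_, ?_⟩
  · have := h.T1 x hWne hx0 _ (hx ⟨⁅x, η x⁆, hW⟩)
    change 0 < -_
    linarith
  · intro ζ hζ hfζ
    obtain ⟨hζ0, y, hy, hy0⟩ := hPC.subset hζ
    change -_ < (0 : ℝ) at hfζ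
    refine hPC.add_mem χ hχ ζ hζ ⟨?_, ⁅x, y⁆, ?_, ?_⟩
    · intro h0
      exact hPC.not_both χ hχ (by rwa [← eq_neg_of_add_eq_zero_right h0])
    · intro H
      exact wt_add (hx H) (hy H)
    · intro h0
      have := h.T2 x y h0 hy0 _ (hy ⟨⁅x, η x⁆, hW⟩)
      linarith

/-- Elements of `gC` centralizing `a` with `η τ z = -z` lie in `a + i a`. -/
lemma mem_a_of (g k p a : Submodule ℝ gC) (hkp : IsCartanDecomposition g k p)
    (ha : IsMaximalAbelianIn a p) (η : gC →ₗ[ℝ] gC)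
    (hk : ∀ x ∈ k, η x = x) (hp : ∀ x ∈ p, η x = -x) (W : gC) (hW : W ∈ g) (hη : η W = -W)
    (hc : ∀ A ∈ a, ⁅A, W⁆ = 0) : W ∈ a := by
  refine ha.maximal W ?_ fun A hA => by rw [← lie_skew, hc A hA, neg_zero]
  rw [← hkp.sup_eq, Submodule.mem_sup] at hW
  obtain ⟨y, hy, z, hz, rfl⟩ := hW
  rw [map_add, hk y hy, hp z hz, neg_add, add_left_inj] at hη
  have : y = 0 := by
    have h2 : (2 : ℂ) • y = 0 := by
      rw [two_smul]; nth_rewrite 1 [hη]; simp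
    simpa using h2
  rw [this, zero_add]
  exact hz

/-- `P` is pointed. -/
lemma CConj.pointedR {η : gC →ₗ[ℝ] gC} (h : CConj η) (g k p a : Submodule ℝ gC)
    (hg : IsRealForm g) (hkp : IsCartanDecomposition g k p) (ha : IsMaximalAbelianIn a p)
    (hk : ∀ x ∈ k, η x = x) (hp : ∀ x ∈ p, η x = -x)
    (τ : gC →ₗ[ℝ] gC) (hτfix : ∀ x : gC, τ x = x ↔ x ∈ g)
    (hcomm : ∀ x, τ (η x) = η (τ x))
    (P : Set (Module.Dual ℝ a)) (hP : IsPositiveSystem g a P)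
    (ψ : Module.Dual ℝ a) (h1 : ψ ∈ AddSubmonoid.closure P)
    (h2 : -ψ ∈ AddSubmonoid.closure P) : ψ = 0 := by
  refine pointed P ?_ ψ h1 h2
  intro ξ hξ
  obtain ⟨hξ0, x, ⟨hxg, hx⟩, hx0⟩ := hP.subset hξ
  have hηA : ∀ A : a, η A = -A := fun A => hp A (ha.le A.2)
  have hηx : ∀ A : a, ⁅(A : gC), η x⁆ = (-((ξ A : ℝ) : ℂ)) • η x := by
    intro A
    have : ⁅(A : gC), η x⁆ = -η ⁅(A : gC), x⁆ := by
      rw [h.lie, hηA, neg_lie, neg_neg]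
    rw [this, hx, h.conj, Complex.conj_ofReal, neg_smul]
  have hηg : η x ∈ g := by rw [← hτfix, hcomm, (hτfix x).2 hxg]
  have hW : ⁅x, η x⁆ ∈ a := by
    refine mem_a_of g k p a hkp ha η hk hp _ (hg.lie_mem _ hxg _ hηg) (h.eta_W x) ?_
    intro A hA
    rw [wt_add (hx ⟨A, hA⟩) (hηx ⟨A, hA⟩), add_neg_cancel, zero_smul]
  let f : Module.Dual ℝ a →+ ℝ :=
    { toFun := fun ψ => -(ψ ⟨⁅x, η x⁆, hW⟩)
      map_zero' := by simp
      map_add' := by intro u v; simp; ring }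
  have hWne : ⁅x, η x⁆ ≠ 0 := by
    intro h0
    apply hξ0
    ext A
    have h3 : κ (A : gC) ⁅x, η x⁆ = (ξ A : ℂ) * κ x (η x) := by
      rw [← kil_lie, hx]; simp
    rw [h0, map_zero] at h3
    simpa [h.ne hx0] using h3.symm
  refine ⟨f, ?_, ?_⟩
  · have := h.T1 x hWne hx0 _ (hx ⟨⁅x, η x⁆, hW⟩)
    rw [Complex.ofReal_re] at this
    change 0 < -_
    linarith
  · intro ζ hζ hfζ
    obtain ⟨hζ0, y, ⟨hyg, hy⟩, hy0⟩ := hP.subset hζ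
    change -_ < (0 : ℝ) at hfζ
    refine hP.add_mem ξ hξ ζ hζ ⟨?_, ⁅x, y⁆, ⟨hg.lie_mem _ hxg _ hyg, ?_⟩, ?_⟩
    · intro h0
      exact hP.not_both ξ hξ (by rwa [← eq_neg_of_add_eq_zero_right h0])
    · intro H
      rw [wt_add (hx H) (hy H), LinearMap.add_apply, Complex.ofReal_add]
    · intro h0
      have := h.T2 x y h0 hy0 _ (hy ⟨⁅x, η x⁆, hW⟩)
      rw [Complex.ofReal_re] at this
      linarith

end Helpers

/-- **Proposition 5.1 (Okuda).** Let `τ` be the conjugation of `gC` with respect to `g`,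
`Alam ∈ a` the coroot of the highest restricted root `lam` (i.e. `Alam = 2 tlam / ⟨λ,λ⟩` where
`tlam ∈ a` is the Killing-dual of `lam`), and `Hphi ∈ h` the coroot of the highest root `φ`
of `Δ⁺(gC,hC)` (i.e. `Hphi = 2 tphi / ⟨φ,φ⟩`).  Then `Alam = Hphi` if `dim_ℝ g_lam = 1` and
`Alam = Hphi + τ Hphi` if `dim_ℝ g_lam ≥ 2`. -/
theorem coroot_of_highest_restricted_root
    {gC : Type*} [LieRing gC] [LieAlgebra ℂ gC] [FiniteDimensional ℂ gC]
    [LieAlgebra.IsSimple ℂ gC]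
    (g k p a : Submodule ℝ gC) (hg : IsRealForm g)
    (hkp : IsCartanDecomposition g k p) (hnoncompact : p ≠ ⊥)
    (ha : IsMaximalAbelianIn a p)
    (P : Set (Module.Dual ℝ a)) (hP : IsPositiveSystem g a P)
    (lam : Module.Dual ℝ a) (hlam : IsHighestRestrictedRoot g a P lam)
    (hC : LieSubalgebra ℂ gC) [hC.IsCartanSubalgebra] (hah : ∀ x ∈ a, x ∈ hC)
    (hspan : Submodule.span ℂ
        ({x : gC | x ∈ hC ∧ Complex.I • x ∈ k} ∪ (a : Set gC)) = hC.toSubmodule)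
    (PC : Set (Module.Dual ℂ hC)) (hPC : IsPositiveSystemC hC PC)
    (hcompat : CompatiblePositiveSystems hC a hah PC P)
    (φ : Module.Dual ℂ hC) (hφ : IsHighestRootC hC PC φ)
    (τ : gC →ₗ[ℝ] gC)
    (hτinv : ∀ x, τ (τ x) = x)
    (hτconj : ∀ (c : ℂ) (x : gC), τ (c • x) = (starRingEnd ℂ) c • τ x)
    (hτfix : ∀ x : gC, τ x = x ↔ x ∈ g)
    (hτlie : ∀ x y : gC, τ ⁅x, y⁆ = ⁅τ x, τ y⁆)
    (tlam : gC) (htlama : tlam ∈ a)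
    (htlamdual : ∀ A' : a, killingForm ℂ gC tlam A' = ((lam A' : ℝ) : ℂ))
    (Alam : gC) (hAlam : Alam = (2 / killingForm ℂ gC tlam tlam) • tlam)
    (tphi : gC) (htphi : tphi ∈ hC)
    (htphidual : ∀ H : hC, killingForm ℂ gC tphi H = φ H)
    (Hphi : gC) (hHphi : Hphi = (2 / killingForm ℂ gC tphi tphi) • tphi) :
    (Module.finrank ℝ (Submodule.span ℝ (restrictedRootSpace g a lam)) = 1 → Alam = Hphi) ∧
    (2 ≤ Module.finrank ℝ (Submodule.span ℝ (restrictedRootSpace g a lam)) →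
      Alam = Hphi + τ Hphi) := by
  obtain ⟨η, h, hk, hp, hcomm⟩ := exists_cconj g k p hg hkp τ hτinv hτconj hτfix hτlie
  have hτkil := kil_conj τ hτinv hτconj hτlie
  have hKill : LieAlgebra.IsKilling ℂ gC := h.isKilling
  have hηa : ∀ A ∈ a, η A = -A := fun A hA => hp A (ha.le hA)
  have hτa : ∀ A ∈ a, τ A = A := fun A hA => (hτfix A).2 (hkp.p_le (ha.le hA))
  have hflip : ∀ f : gC →ₗ[ℝ] gC,
      (∀ (c : ℂ) (x : gC), f (c • x) = (starRingEnd ℂ) c • f x) → ∀ x : gC,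
      f (Complex.I • x) = Complex.I • x → f x = -x := by
    intro f hf x h1
    rw [hf, Complex.conj_I, neg_smul, ← smul_neg] at h1
    exact neg_eq_iff_eq_neg.mp (smul_right_injective gC Complex.I_ne_zero h1)
  have hηt : ∀ x : gC, Complex.I • x ∈ k → η x = -x := fun x hx =>
    hflip η h.conj x (hk _ hx)
  have hτt : ∀ x : gC, Complex.I • x ∈ k → τ x = -x := fun x hx =>
    hflip τ hτconj x ((hτfix _).2 (hkp.k_le hx))
  -- induction on hC
  have hind : ∀ q : gC → Prop, (∀ x ∈ hC, Complex.I • x ∈ k → q x) → (∀ x ∈ a, q x) → q 0 →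
      (∀ x y, q x → q y → q (x + y)) → (∀ (c : ℂ) x, q x → q (c • x)) → ∀ x ∈ hC, q x := by
    intro q h1 h2 h3 h4 h5 x hx
    have hx' : x ∈ Submodule.span ℂ
        ({x : gC | x ∈ hC ∧ Complex.I • x ∈ k} ∪ (a : Set gC)) := by rw [hspan]; exact hx
    refine Submodule.span_induction (p := fun x _ => q x) ?_ h3 (fun x y _ _ => h4 x y)
      (fun c x _ => h5 c x) hx'
    rintro x (⟨hx1, hx2⟩ | hx)
    exacts [h1 x hx1 hx2, h2 x hx]
  have hηh : ∀ H ∈ hC, η H ∈ hC := by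
    refine hind _ ?_ ?_ ?_ ?_ ?_
    · intro x hx hx'; rw [hηt x hx']; exact hC.neg_mem hx
    · intro x hx; rw [hηa x hx]; exact hC.neg_mem (hah x hx)
    · simp
    · intro x y hx hy; rw [map_add]; exact hC.add_mem hx hy
    · intro c x hx; rw [h.conj]; exact hC.smul_mem _ hx
  have hτh : ∀ H ∈ hC, τ H ∈ hC := by
    refine hind _ ?_ ?_ ?_ ?_ ?_
    · intro x hx hx'; rw [hτt x hx']; exact hC.neg_mem hx
    · intro x hx; rw [hτa x hx]; exact hah x hx
    · simp
    · intro x y hx hy; rw [map_add]; exact hC.add_mem hx hy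
    · intro c x hx; rw [hτconj]; exact hC.smul_mem _ hx
  have hab : ∀ x ∈ hC, ∀ y ∈ hC, ⁅x, y⁆ = 0 := by
    intro x hx y hy
    have := trivial_lie_zero hC hC ⟨x, hx⟩ ⟨y, hy⟩
    exact congrArg Subtype.val this
  have hpR := h.pointedR g k p a hg hkp ha hk hp τ hτfix hcomm P hP
  have hpC := h.pointedC hC hηh PC hPC
  obtain ⟨hφ0, e, he, he0⟩ := hPC.subset hφ.1
  have hlamR := hP.subset hlam.1
  -- restriction of sums of positive roots
  have hres : ∀ ψ ∈ AddSubmonoid.closure PC, ∃ ρ ∈ AddSubmonoid.closure P,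
      ∀ A : a, ψ ⟨A, hah A A.2⟩ = ((ρ A : ℝ) : ℂ) := by
    intro ψ hψ
    induction hψ using AddSubmonoid.closure_induction with
    | mem ψ hψ =>
      by_cases hv : VanishesOnA hC a hah ψ
      · exact ⟨0, AddSubmonoid.zero_mem _, fun A => by rw [hv A A.2]; simp⟩
      · obtain ⟨ξ, hξ, hξ'⟩ := hcompat ψ hψ hv
        exact ⟨ξ, AddSubmonoid.subset_closure hξ, fun A => hξ' A A.2⟩
    | zero => exact ⟨0, AddSubmonoid.zero_mem _, fun A => by simp⟩
    | add x y _ _ hx hy =>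
      obtain ⟨ρ, hρ, hρ'⟩ := hx
      obtain ⟨ρ', hρ2, hρ2'⟩ := hy
      exact ⟨ρ + ρ', AddSubmonoid.add_mem _ hρ hρ2, fun A => by simp [hρ', hρ2']⟩
  -- splitting of restricted weight vectors
  have hsplit : ∀ (ξ : Module.Dual ℝ a) (z : gC),
      (∀ A : a, ⁅(A : gC), z⁆ = ((ξ A : ℝ) : ℂ) • z) →
      z + τ z ∈ restrictedRootSpace g a ξ ∧
        Complex.I • (z - τ z) ∈ restrictedRootSpace g a ξ := by
    intro ξ z hz
    have hz' : ∀ A : a, ⁅(A : gC), τ z⁆ = ((ξ A : ℝ) : ℂ) • τ z := by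
      intro A
      have h1 := congrArg τ (hz A)
      rwa [hτlie, hτa A A.2, hτconj, Complex.conj_ofReal] at h1
    refine ⟨⟨?_, ?_⟩, ⟨?_, ?_⟩⟩
    · rw [← hτfix, map_add, hτinv, add_comm]
    · intro A; rw [lie_add, hz, hz', smul_add]
    · rw [← hτfix, hτconj, map_sub, hτinv, Complex.conj_I, neg_smul, ← smul_neg, neg_sub]
    · intro A; rw [lie_smul, lie_sub, hz, hz', ← smul_sub, smul_comm]
  have hsum : ∀ z : gC, z = (1 / 2 : ℂ) • ((z + τ z) - Complex.I • (Complex.I • (z - τ z))) := by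
    intro z
    rw [smul_smul, Complex.I_mul_I]
    module
  -- twice the highest restricted root is not a root
  have h2lam : ∀ z : gC, (∀ A : a, ⁅(A : gC), z⁆ = ((lam A : ℂ) + (lam A : ℂ)) • z) → z = 0 := by
    intro z hz
    have hnot : lam + lam ∉ restrictedRoots g a := by
      intro hmem
      have h1 := hlam.2 _ hmem
      have h2 : lam - (lam + lam) = -lam := by abel
      rw [h2] at h1
      exact hlamR.1 (hpR lam (AddSubmonoid.subset_closure hlam.1) h1)
    have hne : lam + lam ≠ 0 := by
      intro h0
      apply hlamR.1
      ext A
      have h1 := congrArg (fun f : Module.Dual ℝ a => f A) h0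
      simp only [LinearMap.add_apply, LinearMap.zero_apply] at h1 ⊢
      linarith
    have hall : ∀ x ∈ restrictedRootSpace g a (lam + lam), x = 0 := by
      intro x hx
      by_contra hx0
      exact hnot ⟨hne, x, hx, hx0⟩
    obtain ⟨h1, h2⟩ := hsplit (lam + lam) z (fun A => by rw [hz]; simp)
    rw [hsum z, hall _ h1, hall _ h2]
    simp
  -- the complexified restricted root space
  let V : Submodule ℂ gC :=
    { carrier := {x | ∀ A : a, ⁅(A : gC), x⁆ = ((lam A : ℝ) : ℂ) • x}
      add_mem' := by
        intro x y hx hy A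
        rw [lie_add, hx, hy, smul_add]
      zero_mem' := by intro A; simp
      smul_mem' := by
        intro c x hx A
        rw [lie_smul, hx, smul_comm] }
  have hVinv : ∀ H ∈ hC, ∀ x ∈ V, ⁅H, x⁆ ∈ V := by
    intro H hH x hx A
    rw [leibniz_lie, hab _ (hah A A.2) _ hH, zero_lie, zero_add, hx A, lie_smul]
  -- the restriction of φ is lam
  have heA : ∀ A : a, φ ⟨A, hah A A.2⟩ = ((lam A : ℝ) : ℂ) := by
    obtain ⟨x0, hx0, hx0'⟩ := hlamR.2
    have hV : V ≠ ⊥ := by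
      intro hb
      apply hx0'
      have : x0 ∈ V := hx0.2
      rw [hb] at this
      exact this
    obtain ⟨x, hxV, hx0, χ, hχ⟩ := exists_eigenvector hC V hV hVinv
    have hχA : ∀ A : a, χ ⟨A, hah A A.2⟩ = ((lam A : ℝ) : ℂ) := by
      intro A
      have h1 := hχ ⟨A, hah A A.2⟩
      rw [hxV A] at h1
      exact (smul_left_injective ℂ hx0 h1).symm
    have hχ0 : χ ≠ 0 := by
      rintro rfl
      apply hlamR.1
      ext A
      have := hχA A
      simpa using this.symm
    obtain ⟨ρ, hρ, hρ'⟩ := hres _ (hφ.2 χ ⟨hχ0, x, hχ, hx0⟩)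
    have hnv : ¬VanishesOnA hC a hah φ := by
      intro hv
      have h1 : ρ = -lam := by
        ext A
        have h2 := hρ' A
        rw [LinearMap.sub_apply, hv A A.2, hχA] at h2
        have h3 : (-(lam A : ℝ) : ℂ) = ((ρ A : ℝ) : ℂ) := by rw [← h2]; simp
        rw [LinearMap.neg_apply]
        exact_mod_cast h3.symm
      rw [h1] at hρ
      exact hlamR.1 (hpR lam (AddSubmonoid.subset_closure hlam.1) hρ)
    obtain ⟨ξ, hξ, hξ'⟩ := hcompat φ hφ.1 hnv
    have h1 : ρ = ξ - lam := by
      ext A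
      have h2 := hρ' A
      rw [LinearMap.sub_apply, hξ' A A.2, hχA] at h2
      rw [LinearMap.sub_apply]
      exact_mod_cast h2.symm
    have h3 := hlam.2 ξ (hP.subset hξ)
    have h4 : ρ = 0 := hpR ρ hρ (by rw [h1, neg_sub]; exact h3)
    have h5 : ξ = lam := by rw [h1] at h4; exact sub_eq_zero.mp h4
    intro A
    rw [hξ' A A.2, h5]
  have heV : e ∈ V := fun A => by
    rw [← heA A]; exact he ⟨A, hah A A.2⟩
  -- the coroot direction
  have hW : ⁅e, η e⁆ = killingForm ℂ gC e (η e) • tphi := by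
    rw [← sub_eq_zero]
    refine h.nondeg hC hηh _ (hC.sub_mem (h.W_mem hC hηh φ e he0 he) (hC.smul_mem _ htphi)) ?_
    intro H hH
    have h1 := h.W_kil hC hηh φ e he0 he ⟨H, hH⟩
    have h2 := htphidual ⟨H, hH⟩
    simp only at h1 h2
    rw [map_sub, LinearMap.sub_apply, map_smul, LinearMap.smul_apply, h1, h2, smul_eq_mul]
    ring
  have hr0 : killingForm ℂ gC e (η e) ≠ 0 := h.ne he0
  have hηphi : η tphi = -tphi := by
    have h1 := h.eta_W e
    rw [hW, h.conj, h.real e, Complex.conj_ofReal, ← smul_neg] at h1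
    rw [h.real e] at hr0
    exact smul_right_injective gC hr0 h1
  have hτphiC : τ tphi ∈ hC := hτh _ htphi
  have h2t : tphi + τ tphi = (2 : ℂ) • tlam := by
    rw [← sub_eq_zero]
    refine h.nondeg hC hηh _ (hC.sub_mem (hC.add_mem htphi hτphiC)
      (hC.smul_mem _ (hah _ htlama))) ?_
    refine hind _ ?_ ?_ ?_ ?_ ?_
    · intro H hH hH'
      have a1 : killingForm ℂ gC tphi H = (starRingEnd ℂ) (killingForm ℂ gC tphi H) := by
        have := h.kil tphi H
        rw [hηphi, hηt H hH'] at this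
        simpa using this
      have a2 : killingForm ℂ gC (τ tphi) H = -killingForm ℂ gC tphi H := by
        have := hτkil tphi H
        rw [hτt H hH', ← a1, map_neg] at this
        rw [← this, neg_neg]
      have a3 : killingForm ℂ gC tlam H = 0 := by
        have b1 := h.kil tlam H
        have b2 := hτkil tlam H
        rw [hηa _ htlama, hηt H hH'] at b1
        rw [hτa _ htlama, hτt H hH', ← b1] at b2
        simp only [map_neg, LinearMap.neg_apply, neg_neg] at b2
        exact CharZero.neg_eq_self_iff.mp b2
      rw [map_sub, map_add, map_smul, LinearMap.sub_apply, LinearMap.add_apply,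
        LinearMap.smul_apply, a2, a3]
      simp
    · intro A hA
      have a1 := htlamdual ⟨A, hA⟩
      have a2 : killingForm ℂ gC tphi A = ((lam ⟨A, hA⟩ : ℝ) : ℂ) := by
        rw [← heA ⟨A, hA⟩]; exact htphidual ⟨A, hah A hA⟩
      have a3 := hτkil tphi A
      rw [hτa A hA, a2, Complex.conj_ofReal] at a3
      simp only at a1
      rw [map_sub, map_add, map_smul, LinearMap.sub_apply, LinearMap.add_apply,
        LinearMap.smul_apply, a1, a2, a3, smul_eq_mul]
      ring
    · simp
    · intro x y hx hy; rw [map_add, hx, hy, add_zero]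
    · intro c x hx; rw [map_smul, hx, smul_zero]
  have hphiR : ∃ s : ℝ, killingForm ℂ gC tphi tphi = (s : ℂ) := by
    refine ⟨-(killingForm ℂ gC tphi (η tphi)).re, ?_⟩
    rw [Complex.ofReal_neg, ← h.real tphi, hηphi, map_neg, neg_neg]
  obtain ⟨s, hs⟩ := hphiR
  have hreal : τ tphi = tphi → tlam = tphi := by
    intro h1
    rw [h1, ← two_smul ℂ] at h2t
    exact (smul_right_injective gC (two_ne_zero' ℂ) h2t).symm
  constructor
  · intro hdim
    rw [finrank_eq_one_iff'] at hdim
    obtain ⟨⟨X, hX⟩, hX0, hall⟩ := hdim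
    have hX0' : X ≠ 0 := fun h0 => hX0 (Subtype.ext h0)
    have hmul : ∀ w ∈ restrictedRootSpace g a lam, ∃ c : ℝ, c • X = w := by
      intro w hw
      obtain ⟨c, hc⟩ := hall ⟨w, Submodule.subset_span hw⟩
      exact ⟨c, congrArg Subtype.val hc⟩
    have hXg : X ∈ g ∧ X ∈ V := by
      refine Submodule.span_induction (p := fun x _ => x ∈ g ∧ x ∈ V) ?_ ?_ ?_ ?_ hX
      · intro x hx; exact ⟨hx.1, hx.2⟩
      · exact ⟨g.zero_mem, V.zero_mem⟩
      · intro x y _ _ hx hy; exact ⟨g.add_mem hx.1 hy.1, V.add_mem hx.2 hy.2⟩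
      · intro c x _ hx; exact ⟨g.smul_mem c hx.1, V.smul_mem (c : ℂ) hx.2⟩
    obtain ⟨s1, s2⟩ := hsplit lam e heV
    obtain ⟨c1, hc1⟩ := hmul _ s1
    obtain ⟨c2, hc2⟩ := hmul _ s2
    have hec : ∃ c : ℂ, e = c • X := by
      refine ⟨(1 / 2 : ℂ) * ((c1 : ℂ) - Complex.I * (c2 : ℂ)), ?_⟩
      conv_lhs => rw [hsum e, ← hc1, ← hc2]
      rw [mul_smul, sub_smul, mul_smul]
      rfl
    obtain ⟨c, hc⟩ := hec
    have hτW : τ tphi = tphi := by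
      have w1 : τ ⁅X, η X⁆ = ⁅X, η X⁆ := by
        rw [hτlie, hcomm, (hτfix X).2 hXg.1]
      have w2 : ⁅e, η e⁆ = (c * (starRingEnd ℂ) c) • ⁅X, η X⁆ := by
        rw [hc, h.conj, smul_lie, lie_smul, smul_smul]
      have w3 : τ ⁅e, η e⁆ = ⁅e, η e⁆ := by
        rw [w2, hτconj, w1, map_mul, Complex.conj_conj, mul_comm]
      rw [hW, hτconj, h.real e, Complex.conj_ofReal] at w3
      rw [h.real e] at hr0
      exact smul_right_injective gC hr0 w3
    rw [hAlam, hHphi, hreal hτW]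
  · intro hdim
    by_cases hτW : τ tphi = tphi
    · exfalso
      have htl := hreal hτW
      -- the orthogonal complement of `e` in `V`
      let U : Submodule ℂ gC := V ⊓ LinearMap.ker ((killingForm ℂ gC).flip (η e))
      have hUmem : ∀ x, x ∈ U ↔ x ∈ V ∧ killingForm ℂ gC x (η e) = 0 := fun x => Iff.rfl
      have hηe := h.wt_eta hC hηh φ e he0 he
      have hU : U ≠ ⊥ := by
        intro hb
        obtain ⟨Y0, hY0, hY00⟩ := hlamR.2
        have hnot : ∀ x ∈ V, killingForm ℂ gC x (η e) = 0 → x = 0 := by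
          intro x hx hx'
          have : x ∈ U := ⟨hx, hx'⟩
          rw [hb] at this
          exact this
        have hk0 : killingForm ℂ gC Y0 (η e) ≠ 0 := fun h0 => hY00 (hnot Y0 hY0.2 h0)
        have hle : ∀ Y ∈ Submodule.span ℝ (restrictedRootSpace g a lam), ∃ c : ℝ, c • Y0 = Y := by
          intro Y hY
          have hYg : Y ∈ g ∧ Y ∈ V := by
            refine Submodule.span_induction (p := fun x _ => x ∈ g ∧ x ∈ V) ?_ ?_ ?_ ?_ hY
            · intro x hx; exact ⟨hx.1, hx.2⟩
            · exact ⟨g.zero_mem, V.zero_mem⟩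
            · intro x y _ _ hx hy; exact ⟨g.add_mem hx.1 hy.1, V.add_mem hx.2 hy.2⟩
            · intro c x _ hx; exact ⟨g.smul_mem c hx.1, V.smul_mem (c : ℂ) hx.2⟩
          have h1 := hnot (killingForm ℂ gC Y (η e) • Y0 - killingForm ℂ gC Y0 (η e) • Y)
            (V.sub_mem (V.smul_mem _ hY0.2) (V.smul_mem _ hYg.2)) (by
              rw [map_sub, map_smul, map_smul, LinearMap.sub_apply, LinearMap.smul_apply,
                LinearMap.smul_apply, smul_eq_mul, smul_eq_mul]
              ring)
          have h2 : ∃ c : ℂ, Y = c • Y0 := by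
            refine ⟨(killingForm ℂ gC Y0 (η e))⁻¹ * killingForm ℂ gC Y (η e), ?_⟩
            rw [mul_smul, sub_eq_zero.mp h1, inv_smul_smul₀ hk0]
          obtain ⟨c, hc⟩ := h2
          have h3 := (hτfix Y).2 hYg.1
          rw [hc, hτconj, (hτfix Y0).2 hY0.1] at h3
          have h4 : (starRingEnd ℂ) c = c := smul_left_injective ℂ hY00 h3
          obtain ⟨r, hr⟩ := Complex.conj_eq_iff_real.mp h4
          refine ⟨r, ?_⟩
          rw [hc, hr]; rfl
        have hY0s : Y0 ∈ Submodule.span ℝ (restrictedRootSpace g a lam) :=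
          Submodule.subset_span hY0
        have := finrank_le_one (R := ℝ)
          (⟨Y0, hY0s⟩ : Submodule.span ℝ (restrictedRootSpace g a lam)) (by
            rintro ⟨Y, hY⟩
            obtain ⟨c, hc⟩ := hle Y hY
            exact ⟨c, Subtype.ext hc⟩)
        omega
      have hUinv : ∀ H ∈ hC, ∀ x ∈ U, ⁅H, x⁆ ∈ U := by
        intro H hH x hx
        rw [hUmem] at hx ⊢
        refine ⟨hVinv H hH x hx.1, ?_⟩
        have h1 := hηe ⟨H, hH⟩
        simp only at h1
        rw [← lie_skew, map_neg, LinearMap.neg_apply, kil_lie, h1, map_smul, hx.2]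
        simp
      obtain ⟨x, hxU, hx0, χ, hχ⟩ := exists_eigenvector hC U hU hUinv
      have hxV : x ∈ V := hxU.1
      have hxk : killingForm ℂ gC x (η e) = 0 := hxU.2
      have hχA : ∀ A : a, χ ⟨A, hah A A.2⟩ = ((lam A : ℝ) : ℂ) := by
        intro A
        have h1 := hχ ⟨A, hah A A.2⟩
        rw [hxV A] at h1
        exact (smul_left_injective ℂ hx0 h1).symm
      have hχ0 : χ ≠ 0 := by
        rintro rfl
        apply hlamR.1
        ext A
        have := hχA A
        simpa using this.symm
      have hsub := hφ.2 χ ⟨hχ0, x, hχ, hx0⟩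
      have hex : ⁅e, x⁆ = 0 := h2lam _ fun A => wt_add (heV A) (hxV A)
      -- M = [x, η e]
      have hMw : ∀ H : hC, ⁅(H : gC), ⁅x, η e⁆⁆ = (χ - φ) H • ⁅x, η e⁆ := by
        intro H
        rw [wt_add (hχ H) (hηe H), LinearMap.sub_apply, sub_eq_add_neg]
      have htphix : ⁅tphi, x⁆ = killingForm ℂ gC tphi tphi • x := by
        have h1 := hxV ⟨tlam, htlama⟩
        have h2 := htlamdual ⟨tlam, htlama⟩
        simp only at h1 h2
        rw [← h2, htl] at h1
        exact h1
      have hphi0 : tphi ≠ 0 := by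
        rintro rfl
        apply hφ0
        ext H
        have := htphidual H
        simpa using this.symm
      have hpp : killingForm ℂ gC tphi tphi ≠ 0 := by
        intro h0
        apply h.ne hphi0
        rw [hηphi, map_neg, h0, neg_zero]
      have heM : ⁅e, ⁅x, η e⁆⁆ ≠ 0 := by
        rw [leibniz_lie, hex, zero_lie, zero_add, hW, lie_smul, ← lie_skew, htphix]
        intro h0
        simp [hr0, hpp, hx0] at h0
      have hM0 : ⁅x, η e⁆ ≠ 0 := by
        intro h0
        apply heM
        rw [h0, lie_zero]
      by_cases hχφ : χ = φ
      · apply hM0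
        refine h.nondeg hC hηh _ (cartan_cent hC _ ?_) ?_
        · intro H
          rw [hMw, hχφ, sub_self]
          simp
        · intro H hH
          have h1 := hηe ⟨H, hH⟩
          simp only at h1
          rw [kil_lie, ← lie_skew, h1, map_neg, map_smul, hxk]
          simp
      · have hηM := h.wt_eta hC hηh (χ - φ) _ hM0 hMw
        have hηMe : ⁅η ⁅x, η e⁆, e⁆ = 0 := by
          by_contra hne
          have hroot : φ - (χ - φ) ∈ rootsC hC := by
            refine ⟨?_, ⁅η ⁅x, η e⁆, e⁆, ?_, hne⟩
            · intro h0
              apply hlamR.1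
              ext A
              have h1 := congrArg (fun f : Module.Dual ℂ hC => f ⟨A, hah A A.2⟩) h0
              simp only [LinearMap.sub_apply, heA, hχA, LinearMap.zero_apply] at h1
              simpa using h1
            · intro H
              rw [wt_add (hηM H) (he H)]
              congr 1
              rw [LinearMap.sub_apply φ]
              ring
          have h1 := hφ.2 _ hroot
          have h2 : φ - (φ - (χ - φ)) = -(φ - χ) := by abel
          rw [h2] at h1
          exact hχφ (sub_eq_zero.mp (hpC _ hsub h1)).symm
        have hnorm := h.normid (η ⁅x, η e⁆) e hηMe
        rw [h.inv] at hnorm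
        have hWM : ⁅η ⁅x, η e⁆, ⁅x, η e⁆⁆ ∈ hC := by
          refine cartan_cent hC _ fun H => ?_
          rw [wt_add (hηM H) (hMw H), neg_add_cancel, zero_smul]
        have hz : φ ⟨⁅η ⁅x, η e⁆, ⁅x, η e⁆⁆, hWM⟩ = 0 := by
          rw [← htphidual]
          change killingForm ℂ gC tphi ⁅η ⁅x, η e⁆, ⁅x, η e⁆⁆ = 0
          have h1 := hηM ⟨tphi, htphi⟩
          have h2 := hχA ⟨tlam, htlama⟩
          have h3 := heA ⟨tlam, htlama⟩
          simp only [htl] at h1 h2 h3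
          rw [LinearMap.sub_apply, h2, h3, sub_self, neg_zero, zero_smul] at h1
          rw [← kil_lie, h1, map_zero, LinearMap.zero_apply]
        have h5 := he ⟨⁅η ⁅x, η e⁆, ⁅x, η e⁆⁆, hWM⟩
        rw [hz, zero_smul] at h5
        simp only at h5
        rw [h5, map_zero, LinearMap.zero_apply] at hnorm
        have hne : ⁅⁅x, η e⁆, e⁆ ≠ 0 := by
          intro h0
          apply heM
          rw [← lie_skew, h0, neg_zero]
        exact h.ne hne (neg_eq_zero.mp hnorm.symm)
    · -- orthogonality
      have hort : killingForm ℂ gC tphi (τ tphi) = 0 := by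
        have hy0 : η (τ e) ≠ 0 := by
          apply h.eta_ne
          intro h0
          apply he0
          rw [← hτinv e, h0, map_zero]
        have hyA : ∀ A : a, ⁅(A : gC), η (τ e)⁆ = (-((lam A : ℝ) : ℂ)) • η (τ e) := by
          intro A
          have h1 : ⁅(A : gC), η (τ e)⁆ = -η (τ ⁅(A : gC), e⁆) := by
            rw [hτlie, h.lie, hτa A A.2, hηa A A.2, neg_lie, neg_neg]
          rw [h1, heV A, hτconj, h.conj, Complex.conj_conj, neg_smul]
        have hyphi : ⁅tphi, η (τ e)⁆ = (-killingForm ℂ gC tphi (τ tphi)) • η (τ e) := by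
          have h1 : ⁅tphi, η (τ e)⁆ = -η (τ ⁅τ tphi, e⁆) := by
            rw [hτlie, h.lie, hτinv, hηphi, neg_lie, neg_neg]
          have h2 := he ⟨τ tphi, hτphiC⟩
          have h3 := htphidual ⟨τ tphi, hτphiC⟩
          rw [← h3] at h2
          simp only at h2
          rw [h1, h2, hτconj, h.conj, Complex.conj_conj, neg_smul]
        have hephi : ⁅tphi, e⁆ = killingForm ℂ gC tphi tphi • e := by
          have h2 := he ⟨tphi, htphi⟩
          rw [← htphidual ⟨tphi, htphi⟩] at h2
          exact h2
        have hzz : ⁅e, η (τ e)⁆ = 0 := by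
          by_contra hz0
          have hzA : ∀ A : a, ⁅(A : gC), ⁅e, η (τ e)⁆⁆ = (((0 : Module.Dual ℝ a) A : ℝ) : ℂ) •
              ⁅e, η (τ e)⁆ := by
            intro A
            rw [wt_add (heV A) (hyA A)]; simp
          have hηz : η ⁅e, η (τ e)⁆ = -τ ⁅e, η (τ e)⁆ := by
            rw [h.lie, h.inv, hτlie, hcomm, hτinv, lie_skew]
          have hητz : η (τ ⁅e, η (τ e)⁆) = -⁅e, η (τ e)⁆ := by
            rw [← neg_eq_iff_eq_neg, ← map_neg, ← hηz, h.inv]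
          obtain ⟨s1, s2⟩ := hsplit 0 _ hzA
          have m1 := mem_a_of g k p a hkp ha η hk hp _ s1.1 (by
            rw [map_add, hηz, hητz]; abel) (fun A hA => by
            have := s1.2 ⟨A, hA⟩
            simpa using this)
          have m2 := mem_a_of g k p a hkp ha η hk hp _ s2.1 (by
            rw [h.conj, map_sub, hηz, hητz, Complex.conj_I, neg_smul]; congr 2; abel)
            (fun A hA => by
            have := s2.2 ⟨A, hA⟩
            simpa using this)
          have hzC : ⁅e, η (τ e)⁆ ∈ hC := by
            rw [hsum ⁅e, η (τ e)⁆]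
            exact hC.smul_mem _ (hC.sub_mem (hah _ m1) (hC.smul_mem _ (hah _ m2)))
          have h1 := hab _ htphi _ hzC
          rw [wt_add hephi hyphi] at h1
          have h2 : killingForm ℂ gC tphi tphi = killingForm ℂ gC tphi (τ tphi) := by
            rcases smul_eq_zero.mp h1 with h3 | h3
            · linear_combination h3
            · exact absurd h3 hz0
          apply hτW
          have hD : tphi - τ tphi = 0 := by
            by_contra hD0
            apply h.ne hD0
            have h3 := hτkil tphi tphi
            rw [hs, Complex.conj_ofReal, ← hs] at h3
            rw [map_sub η, ← hcomm, hηphi]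
            simp only [map_sub, map_neg, LinearMap.sub_apply, h3, ← h2,
              kil_comm (τ tphi) tphi]
            ring
          exact (sub_eq_zero.mp hD).symm
        have hff : ⁅η e, η (τ e)⁆ = 0 := by
          rw [← h.lie]
          have : ⁅e, τ e⁆ = 0 := by
            apply h2lam
            intro A
            refine wt_add (heV A) ?_
            have h1 := congrArg τ (heV A)
            rwa [hτlie, hτa A A.2, hτconj, Complex.conj_ofReal] at h1
          rw [this, map_zero]
        have h1 : ⁅⁅e, η e⁆, η (τ e)⁆ = 0 := by
          rw [lie_lie, hff, hzz, lie_zero, lie_zero, sub_zero]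
        rw [hW, smul_lie, hyphi] at h1
        simpa [hr0, hy0] using h1
      have h3 := hτkil tphi tphi
      rw [hs, Complex.conj_ofReal, ← hs] at h3
      have htl : tlam = (1 / 2 : ℂ) • (tphi + τ tphi) := by
        rw [h2t, smul_smul]; norm_num
      have hll : killingForm ℂ gC tlam tlam = (1 / 2 : ℂ) * killingForm ℂ gC tphi tphi := by
        rw [htl]
        simp only [map_smul, map_add, LinearMap.smul_apply, LinearMap.add_apply, smul_eq_mul,
          h3, hort, kil_comm (τ tphi) tphi]
        ring
      have hc : (starRingEnd ℂ) (2 / killingForm ℂ gC tphi tphi)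
          = 2 / killingForm ℂ gC tphi tphi := by
        rw [hs, map_div₀, Complex.conj_ofReal, Complex.conj_ofNat]
      rw [hAlam, hHphi, hτconj, hc, hll, htl, smul_smul, ← smul_add]
      congr 1
      rw [div_mul_div_comm, mul_one]
      by_cases h0 : killingForm ℂ gC tphi tphi = 0
      · rw [h0]; simp
      · field_simp

end SmallestOrbitPaper
end

section
/- Let g be a non-compact real simple Lie algebra without complex structure, τ the conjugation of g_C with respect to g, A_λ ∈ a the coroot of the highest restricted root λ, and H_φ ∈ h the coroot of the highest root φ of Δ+(g_C,h_C). Then A_λ = (⟨φ,φ⟩ / (2⟨λ,λ⟩)) · (H_φ + τ(H_φ)), where ⟨·,·⟩ denotes the inner products on h* and a* induced by the Killing form of g_C. In particular, if φ is a real root then A_λ = H_φ. -/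
/-!
Common definitions: a complex simple Lie algebra `gC`, real forms, Cartan decompositions,
restricted roots, inner automorphism groups, adjoint orbits and the closure ordering.
-/

open LieAlgebra Set

namespace SmallestOrbitPaper

variable {gC : Type*} [LieRing gC] [LieAlgebra ℂ gC]

/-! ### Helper lemmas -/


/-- Pulling back along a conjugation conjugates the trace. -/
lemma trace_conj_aux {V : Type*} [AddCommGroup V] [Module ℂ V] [FiniteDimensional ℂ V]
    (τ : V → V) (hadd : ∀ x y, τ (x + y) = τ x + τ y)
    (hinv : ∀ x, τ (τ x) = x)
    (hsmul : ∀ (c : ℂ) (x : V), τ (c • x) = (starRingEnd ℂ) c • τ x)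
    (f f' : V →ₗ[ℂ] V) (hf : ∀ x, f' (τ x) = τ (f x)) :
    LinearMap.trace ℂ V f' = (starRingEnd ℂ) (LinearMap.trace ℂ V f) := by
  classical
  let b := Module.finBasis ℂ V
  let e : V ≃ₗ[ℂ] (Fin (Module.finrank ℂ V) → ℂ) :=
    { toFun := fun x i => (starRingEnd ℂ) (b.equivFun (τ x) i)
      invFun := fun v => τ (b.equivFun.symm (fun i => (starRingEnd ℂ) (v i)))
      map_add' := fun x y => by
        funext i; simp [hadd]
      map_smul' := fun c x => by
        funext i; simp [hsmul]
      left_inv := fun x => by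
        simp [hinv]
      right_inv := fun v => by
        funext i
        simp only [hinv, LinearEquiv.apply_symm_apply, Complex.conj_conj] }
  let b' : Module.Basis _ ℂ V := Module.Basis.ofEquivFun e
  have hb' : ∀ i, b' i = τ (b i) := by
    intro i
    have : b' i = e.symm (Pi.single i 1) := by simp [b', Module.Basis.coe_ofEquivFun]
    rw [this]
    change τ (b.equivFun.symm (fun j => (starRingEnd ℂ) ((Pi.single i 1 : _ → ℂ) j))) = _
    congr 1
    have hs : (fun j => (starRingEnd ℂ) ((Pi.single i 1 : _ → ℂ) j)) = Pi.single i 1 := by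
      funext j
      by_cases h : j = i
      · subst h; simp
      · simp [Pi.single_eq_of_ne h]
    rw [hs, LinearEquiv.symm_apply_eq]
    simp [Finsupp.single_eq_pi_single]
  rw [LinearMap.trace_eq_matrix_trace ℂ b' f', LinearMap.trace_eq_matrix_trace ℂ b f]
  simp only [Matrix.trace, Matrix.diag, LinearMap.toMatrix_apply, map_sum]
  refine Finset.sum_congr rfl fun i _ => ?_
  rw [hb', hf]
  have : b'.repr (τ (f (b i))) i = e (τ (f (b i))) i := by
    rw [← Module.Basis.equivFun_apply]; simp [b']
  rw [this]
  change (starRingEnd ℂ) (b.equivFun (τ (τ (f (b i)))) i) = _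
  rw [hinv]; rfl

lemma killing_conj [FiniteDimensional ℂ gC] (τ : gC →ₗ[ℝ] gC)
    (hτinv : ∀ x, τ (τ x) = x)
    (hτconj : ∀ (c : ℂ) (x : gC), τ (c • x) = (starRingEnd ℂ) c • τ x)
    (hτlie : ∀ x y : gC, τ ⁅x, y⁆ = ⁅τ x, τ y⁆) (x y : gC) :
    killingForm ℂ gC (τ x) (τ y) = (starRingEnd ℂ) (killingForm ℂ gC x y) := by
  rw [killingForm_apply_apply, killingForm_apply_apply]
  apply trace_conj_aux τ (map_add τ) hτinv hτconj
  intro z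
  simp [hτlie]


lemma real_smul_eq (r : ℝ) (x : gC) : (r : ℂ) • x = r • x := rfl

lemma complex_smul_aux (c : ℂ) (x y : gC) : c • (x + Complex.I • y) =
    (c.re • x - c.im • y) + Complex.I • (c.im • x + c.re • y) := by
  conv_lhs => rw [← Complex.re_add_im c]
  rw [← real_smul_eq, ← real_smul_eq, ← real_smul_eq, ← real_smul_eq]
  have := Complex.I_mul_I
  match_scalars
  · ring
  · linear_combination (c.im : ℂ) * this

lemma mem_span_iff (V : Submodule ℝ gC) (v : gC) :
    v ∈ Submodule.span ℂ (V : Set gC) ↔ ∃ x ∈ V, ∃ y ∈ V, v = x + Complex.I • y := by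
  constructor
  · intro h
    induction h using Submodule.span_induction with
    | mem x hx => exact ⟨x, hx, 0, V.zero_mem, by simp⟩
    | zero => exact ⟨0, V.zero_mem, 0, V.zero_mem, by simp⟩
    | add v w _ _ hv hw =>
      obtain ⟨x, hx, y, hy, rfl⟩ := hv
      obtain ⟨x', hx', y', hy', rfl⟩ := hw
      exact ⟨x + x', V.add_mem hx hx', y + y', V.add_mem hy hy', by module⟩
    | smul c v _ hv =>
      obtain ⟨x, hx, y, hy, rfl⟩ := hv
      exact ⟨_, V.sub_mem (V.smul_mem c.re hx) (V.smul_mem c.im hy), _,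
        V.add_mem (V.smul_mem c.im hx) (V.smul_mem c.re hy), complex_smul_aux c x y⟩
  · rintro ⟨x, hx, y, hy, rfl⟩
    exact Submodule.add_mem _ (Submodule.subset_span hx)
      (Submodule.smul_mem _ _ (Submodule.subset_span hy))

lemma isCompl_span {g k p : Submodule ℝ gC} (hg : IsRealForm g)
    (hkp : IsCartanDecomposition g k p) :
    IsCompl (Submodule.span ℂ (k : Set gC)) (Submodule.span ℂ (p : Set gC)) := by
  constructor
  · rw [Submodule.disjoint_def]
    intro v hv hv'
    rw [mem_span_iff] at hv hv'
    obtain ⟨x, hx, y, hy, rfl⟩ := hv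
    obtain ⟨x', hx', y', hy', h⟩ := hv'
    have h1 : Complex.I • (y - y') = x' - x := by
      rw [smul_sub, sub_eq_sub_iff_add_eq_add, add_comm, h]
    have h2 : y - y' = 0 := hg.indep _ (g.sub_mem (hkp.k_le hy) (hkp.p_le hy'))
      (h1 ▸ g.sub_mem (hkp.p_le hx') (hkp.k_le hx))
    rw [h2, smul_zero] at h1
    have hy0 : y ∈ k ⊓ p := ⟨hy, (sub_eq_zero.mp h2) ▸ hy'⟩
    have hx0 : x ∈ k ⊓ p := ⟨hx, (sub_eq_zero.mp h1.symm) ▸ hx'⟩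
    rw [hkp.inf_eq, Submodule.mem_bot] at hy0 hx0
    simp [hy0, hx0]
  · rw [codisjoint_iff, eq_top_iff]
    intro z _
    obtain ⟨x, hx, y, hy, rfl⟩ := hg.spans z
    have key : ∀ x ∈ g, x ∈ Submodule.span ℂ (k : Set gC) ⊔ Submodule.span ℂ (p : Set gC) := by
      intro x hx
      rw [← hkp.sup_eq] at hx
      obtain ⟨u, hu, w, hw, rfl⟩ := Submodule.mem_sup.mp hx
      exact Submodule.add_mem_sup (Submodule.subset_span hu) (Submodule.subset_span hw)
    exact Submodule.add_mem _ (key x hx) (Submodule.smul_mem _ _ (key y hy))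

lemma lie_mem_span {A B : Submodule ℝ gC} {x : gC} (h : ∀ y ∈ A, ⁅x, y⁆ ∈ B) {v : gC}
    (hv : v ∈ Submodule.span ℂ (A : Set gC)) : ⁅x, v⁆ ∈ Submodule.span ℂ (B : Set gC) := by
  rw [mem_span_iff] at hv ⊢
  obtain ⟨y, hy, z, hz, rfl⟩ := hv
  exact ⟨_, h y hy, _, h z hz, by rw [lie_add, lie_smul]⟩

lemma killing_kp [FiniteDimensional ℂ gC] {g k p : Submodule ℝ gC} (hg : IsRealForm g)
    (hkp : IsCartanDecomposition g k p) {x y : gC} (hx : x ∈ k) (hy : y ∈ p) :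
    killingForm ℂ gC x y = 0 := by
  rw [killingForm_apply_apply]
  let N : Bool → Submodule ℂ gC := fun b =>
    Submodule.span ℂ ((if b then k else p : Submodule ℝ gC) : Set gC)
  have hN : DirectSum.IsInternal N := by
    rw [DirectSum.isInternal_submodule_iff_isCompl N (i := true) (j := false) (by simp)
      (by ext b; cases b <;> simp)]
    simpa [N] using isCompl_span hg hkp
  refine LinearMap.trace_eq_zero_of_mapsTo_ne hN Bool.not (by simp) ?_
  intro b v hv
  cases b
  · exact lie_mem_span (A := k) (B := k) (hkp.lie_kk x hx)
      (lie_mem_span (A := p) (B := k) (hkp.lie_pp y hy) hv)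
  · refine lie_mem_span (A := p) (B := p) (hkp.lie_kp x hx)
      (lie_mem_span (A := k) (B := p) (fun z hz => ?_) hv)
    rw [← lie_skew]
    exact p.neg_mem (hkp.lie_kp z hz y hy)

/-- Eigenvalues of `ad Y` for `Y ∈ k` are purely imaginary. -/
lemma conj_eigenvalue {g k p : Submodule ℝ gC} (hg : IsRealForm g)
    (hkp : IsCartanDecomposition g k p) {Y v : gC} (hY : Y ∈ k) (hv : v ≠ 0) {c : ℂ}
    (h : ⁅Y, v⁆ = c • v) : (starRingEnd ℂ) c = - c := by
  have hcompl := isCompl_span hg hkp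
  -- the eigenvector in a homogeneous component
  have main : ∀ (V : Submodule ℝ gC) (ε : ℝ), (∀ x ∈ V, ⁅Y, x⁆ ∈ V) → V ≤ g →
      (∀ x ∈ V, x ≠ 0 → 0 < ε * (killingForm ℂ gC x x).re) →
      ∀ v ∈ Submodule.span ℂ (V : Set gC), v ≠ 0 → ⁅Y, v⁆ = c • v →
      (starRingEnd ℂ) c = - c := by
    intro V ε hV hVg hpos v hv hv0 h
    rw [mem_span_iff] at hv
    obtain ⟨x, hx, y, hy, rfl⟩ := hv
    rw [complex_smul_aux, lie_add, lie_smul] at h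
    have h1 : Complex.I • (⁅Y, y⁆ - (c.im • x + c.re • y)) =
        (c.re • x - c.im • y) - ⁅Y, x⁆ := by
      rw [smul_sub, sub_eq_sub_iff_add_eq_add, add_comm, h]
    have hm1 : (c.re • x - c.im • y) ∈ g :=
      hVg (V.sub_mem (V.smul_mem c.re hx) (V.smul_mem c.im hy))
    have hm2 : (c.im • x + c.re • y) ∈ g :=
      hVg (V.add_mem (V.smul_mem c.im hx) (V.smul_mem c.re hy))
    have h2 := hg.indep _ (g.sub_mem (hVg (hV y hy)) hm2)
      (h1 ▸ g.sub_mem hm1 (hVg (hV x hx)))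
    rw [h2, smul_zero] at h1
    replace h1 := (sub_eq_zero.mp h1.symm).symm
    replace h2 := sub_eq_zero.mp h2
    have k1 : ∀ z : gC, killingForm ℂ gC ⁅Y, z⁆ z = 0 := by
      intro z
      have a1 := LieModule.traceForm_apply_lie_apply' ℂ gC gC Y z z
      have a2 := LieModule.traceForm_comm ℂ gC gC ⁅Y, z⁆ z
      change (LieModule.traceForm ℂ gC gC) _ _ = 0
      rw [← a2] at a1
      exact self_eq_neg.mp a1
    have e1 := k1 x
    have e2 := k1 y
    rw [h1] at e1
    rw [h2] at e2
    have e3 := LieModule.traceForm_comm ℂ gC gC x y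
    change killingForm ℂ gC x y = killingForm ℂ gC y x at e3
    simp only [← real_smul_eq, map_sub, map_add, map_smul, LinearMap.sub_apply,
      LinearMap.add_apply, LinearMap.smul_apply, smul_eq_mul] at e1 e2
    rw [← e3] at e1
    have e4 : (c.re : ℂ) * (killingForm ℂ gC x x + killingForm ℂ gC y y) = 0 := by
      linear_combination e1 + e2
    have e5 : c.re * ((killingForm ℂ gC x x).re + (killingForm ℂ gC y y).re) = 0 := by
      have := congrArg Complex.re e4
      simpa using this
    have hre : c.re = 0 := by
      rcases mul_eq_zero.mp e5 with h | h
      · exact h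
      · exfalso
        have px : 0 ≤ ε * (killingForm ℂ gC x x).re := by
          by_cases h0 : x = 0
          · simp [h0]
          · exact (hpos x hx h0).le
        have py : 0 ≤ ε * (killingForm ℂ gC y y).re := by
          by_cases h0 : y = 0
          · simp [h0]
          · exact (hpos y hy h0).le
        have hs : ε * (killingForm ℂ gC x x).re + ε * (killingForm ℂ gC y y).re = 0 := by
          rw [← mul_add, h, mul_zero]
        apply hv0
        have x0 : x = 0 := by
          by_contra h0
          have := hpos x hx h0
          linarith
        have y0 : y = 0 := by
          by_contra h0
          have := hpos y hy h0
          linarith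
        simp [x0, y0]
    apply Complex.ext <;> simp [hre]
  obtain ⟨v1, hv1, v2, hv2, rfl⟩ := Submodule.mem_sup.mp
    (show v ∈ _ from hcompl.sup_eq_top ▸ Submodule.mem_top : v ∈
      Submodule.span ℂ (k : Set gC) ⊔ Submodule.span ℂ (p : Set gC))
  have hm1 : ⁅Y, v1⁆ - c • v1 ∈ Submodule.span ℂ (k : Set gC) :=
    Submodule.sub_mem _ (lie_mem_span (hkp.lie_kk Y hY) hv1) (Submodule.smul_mem _ _ hv1)
  have hm2 : c • v2 - ⁅Y, v2⁆ ∈ Submodule.span ℂ (p : Set gC) :=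
    Submodule.sub_mem _ (Submodule.smul_mem _ _ hv2) (lie_mem_span (hkp.lie_kp Y hY) hv2)
  have heq : ⁅Y, v1⁆ - c • v1 = c • v2 - ⁅Y, v2⁆ := by
    rw [sub_eq_sub_iff_add_eq_add, ← lie_add, h, smul_add, add_comm]
  have hz : ⁅Y, v1⁆ - c • v1 = 0 :=
    (Submodule.disjoint_def.mp hcompl.disjoint) _ hm1 (heq ▸ hm2)
  have hz' := heq.symm.trans hz
  by_cases h1 : v1 = 0
  · have h2 : v2 ≠ 0 := by
      rintro rfl
      exact hv (by simp [h1])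
    exact main p 1 (hkp.lie_kp Y hY) hkp.p_le
      (fun x hx h0 => by simpa using hkp.killing_pos x hx h0) v2 hv2 h2 (sub_eq_zero.mp hz').symm
  · exact main k (-1) (hkp.lie_kk Y hY) hkp.k_le
      (fun x hx h0 => by simpa using hkp.killing_neg x hx h0) v1 hv1 h1 (sub_eq_zero.mp hz)

section Roots

variable [FiniteDimensional ℂ gC] [LieAlgebra.IsSimple ℂ gC]
  {hC : LieSubalgebra ℂ gC} [hC.IsCartanSubalgebra]

open LieAlgebra.IsKilling in
lemma exists_weight_of_mem_rootsC {χ : Module.Dual ℂ hC} (hχ : χ ∈ rootsC hC) :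
    ∃ i : hC.root, (rootSystem hC).root i = χ := by
  obtain ⟨h0, x, hx, hx0⟩ := hχ
  let α : LieModule.Weight ℂ hC gC :=
    { toFun := χ
      genWeightSpace_ne_bot' := by
        intro hbot
        apply hx0
        have : x ∈ LieModule.genWeightSpace gC (χ : hC → ℂ) := by
          apply LieModule.weightSpace_le_genWeightSpace
          rw [LieModule.mem_weightSpace]
          exact hx
        rw [hbot] at this
        simpa using this }
  have hα : α.IsNonZero := by
    intro h
    apply h0
    ext y
    exact congrFun h y
  refine ⟨⟨α, by simpa using hα⟩, ?_⟩
  ext y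
  rfl

open LieAlgebra.IsKilling in
lemma root_mem_rootsC (i : hC.root) : (rootSystem hC).root i ∈ rootsC hC := by
  refine ⟨(rootSystem hC).ne_zero i, ?_⟩
  obtain ⟨e, he0, he⟩ := LieModule.exists_forall_lie_eq_smul ℂ hC gC i.1
  exact ⟨e, he, he0⟩

open LieAlgebra.IsKilling in
lemma pointed_s11 {PC : Set (Module.Dual ℂ hC)} (hPC : IsPositiveSystemC hC PC) :
    ∀ (n : ℕ) (s : Multiset (Module.Dual ℂ hC)), s.card = n → (∀ χ ∈ s, χ ∈ PC) →
      s.sum = 0 → s = 0 := by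
  intro n
  induction n using Nat.strong_induction_on with
  | _ n ih =>
  intro s hs hmem hsum
  by_contra hne
  obtain ⟨α, hα⟩ := Multiset.exists_mem_of_ne_zero hne
  obtain ⟨t, rfl⟩ := Multiset.exists_cons_of_mem hα
  have hαP := hmem α hα
  obtain ⟨i, hi⟩ := exists_weight_of_mem_rootsC (hPC.subset hαP)
  -- some element of `t` pairs negatively with `α`
  have hex : ∃ j : hC.root, (rootSystem hC).root j ∈ t ∧ (rootSystem hC).pairingIn ℤ j i < 0 := by
    by_contra hcon
    push Not at hcon
    have hnn : ∀ u : Multiset (Module.Dual ℂ hC), u ≤ t →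
        ∃ m : ℕ, u.sum ((rootSystem hC).coroot i) = (m : ℂ) := by
      intro u
      induction u using Multiset.induction_on with
      | empty => intro _; exact ⟨0, by simp⟩
      | cons β u ihu =>
        intro hu
        obtain ⟨m, hm⟩ := ihu (le_trans (Multiset.le_cons_self u β) hu)
        have hβ : β ∈ t := Multiset.mem_of_le hu (Multiset.mem_cons_self β u)
        obtain ⟨j, hj⟩ := exists_weight_of_mem_rootsC
          (hPC.subset (hmem β (Multiset.mem_cons_of_mem hβ)))
        have hp := hcon j (hj ▸ hβ)
        obtain ⟨l, hl⟩ := Int.eq_ofNat_of_zero_le hp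
        refine ⟨l + m, ?_⟩
        have h1 : β ((rootSystem hC).coroot i) = (l : ℂ) := by
          have h2 := (rootSystem hC).algebraMap_pairingIn ℤ j i
          rw [hl] at h2
          rw [← hj]
          change (rootSystem hC).pairing j i = _
          rw [← h2]
          simp
        rw [Multiset.sum_cons, LinearMap.add_apply, h1, hm]
        push_cast
        ring
    obtain ⟨m, hm⟩ := hnn t le_rfl
    have h0 := congrArg (fun f : Module.Dual ℂ hC => f ((rootSystem hC).coroot i)) hsum
    simp only [Multiset.sum_cons, LinearMap.add_apply, hm, LinearMap.zero_apply] at h0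
    have h2 : α ((rootSystem hC).coroot i) = 2 := by
      rw [← hi]
      exact (rootSystem hC).pairing_same i
    rw [h2] at h0
    have : ((2 + m : ℕ) : ℂ) = 0 := by push_cast; exact h0
    rw [Nat.cast_eq_zero] at this
    omega
  obtain ⟨j, hjt, hneg⟩ := hex
  have hjP := hmem _ (Multiset.mem_cons_of_mem hjt)
  have hne' : (rootSystem hC).root j ≠ -(rootSystem hC).root i := by
    intro h
    rw [hi] at h
    rw [h] at hjP
    exact hPC.not_both α hαP hjP
  obtain ⟨l, hl⟩ := (rootSystem hC).root_add_root_mem_of_pairingIn_neg hneg hne'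
  rw [hi] at hl
  have hnewP : (rootSystem hC).root j + α ∈ PC :=
    hPC.add_mem _ hjP _ hαP (hl ▸ root_mem_rootsC l)
  obtain ⟨u, rfl⟩ := Multiset.exists_cons_of_mem hjt
  have := ih (u.card + 1) (by simp at hs; omega) (((rootSystem hC).root j + α) ::ₘ u) (by simp)
    (by
      intro χ hχ
      rcases Multiset.mem_cons.mp hχ with rfl | hχ
      · exact hnewP
      · exact hmem _ (Multiset.mem_cons_of_mem (Multiset.mem_cons_of_mem hχ)))
    (by
      rw [← hsum]
      simp only [Multiset.sum_cons]
      abel)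
  simp at this

/-- Every restricted root is the restriction of a root. -/
lemma exists_lift {g a : Submodule ℝ gC} (hah : ∀ x ∈ a, x ∈ hC) {ξ : Module.Dual ℝ a}
    (hξ : ξ ∈ restrictedRoots g a) :
    ∃ χ ∈ rootsC hC, ∀ x : gC, ∀ hx : x ∈ a, χ ⟨x, hah x hx⟩ = ((ξ ⟨x, hx⟩ : ℝ) : ℂ) := by
  obtain ⟨hξ0, x, ⟨-, hx⟩, hx0⟩ := hξ
  let E : LieSubmodule ℂ hC gC :=
    { carrier := {v | ∀ H : a, ⁅(H : gC), v⁆ = ((ξ H : ℝ) : ℂ) • v}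
      add_mem' := fun {v w} hv hw H => by
        rw [lie_add, hv H, hw H, smul_add]
      zero_mem' := fun H => by simp
      smul_mem' := fun c v hv H => by
        rw [lie_smul, hv H, smul_comm]
      lie_mem := fun {h v} hv H => by
        have hcomm : ⁅(H : gC), (h : gC)⁆ = 0 := by
          have : ⁅(⟨H, hah _ H.2⟩ : hC), h⁆ = 0 := trivial_lie_zero _ _ _ _
          simpa using congrArg Subtype.val this
        change ⁅(H : gC), ⁅(h : gC), v⁆⁆ = _ • ⁅(h : gC), v⁆
        rw [leibniz_lie, hcomm, zero_lie, zero_add, hv H, lie_smul] }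
  have : Nontrivial E := ⟨⟨⟨x, hx⟩, 0, fun h => hx0 (congrArg Subtype.val h)⟩⟩
  obtain ⟨χ, hχ⟩ := LieModule.exists_nontrivial_weightSpace_of_isSolvable ℂ hC E
  obtain ⟨⟨⟨v, hvE⟩, hv⟩, hv0⟩ := exists_ne (0 : LieModule.weightSpace E χ)
  rw [LieModule.mem_weightSpace] at hv
  have hv0' : v ≠ 0 := fun h => hv0 (by ext; exact h)
  have hvχ : ∀ H : hC, ⁅(H : gC), v⁆ = χ H • v := fun H => congrArg Subtype.val (hv H)
  have hres : ∀ x : gC, ∀ hx : x ∈ a, χ ⟨x, hah x hx⟩ = ((ξ ⟨x, hx⟩ : ℝ) : ℂ) := by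
    intro y hy
    have h1 := hvχ ⟨y, hah y hy⟩
    have h2 := hvE ⟨y, hy⟩
    exact smul_left_injective ℂ hv0' (h1.symm.trans h2)
  refine ⟨χ, ⟨?_, v, hvχ, hv0'⟩, hres⟩
  rintro rfl
  apply hξ0
  ext H
  have := hres H.1 H.2
  simpa using this.symm

end Roots

/-- Two functionals on `hC` agreeing on `a` and on `√-1 t` are equal. -/
lemma dual_ext {k a : Submodule ℝ gC} {hC : LieSubalgebra ℂ gC} (hah : ∀ x ∈ a, x ∈ hC)
    (hspan : Submodule.span ℂ
        ({x : gC | x ∈ hC ∧ Complex.I • x ∈ k} ∪ (a : Set gC)) = hC.toSubmodule)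
    {χ ψ : Module.Dual ℂ hC}
    (h1 : ∀ x : gC, ∀ hx : x ∈ a, χ ⟨x, hah x hx⟩ = ψ ⟨x, hah x hx⟩)
    (h2 : ∀ x : gC, ∀ hx : x ∈ hC, Complex.I • x ∈ k → χ ⟨x, hx⟩ = ψ ⟨x, hx⟩) : χ = ψ := by
  have key : ∀ x ∈ Submodule.span ℂ ({x : gC | x ∈ hC ∧ Complex.I • x ∈ k} ∪ (a : Set gC)),
      ∃ hx : x ∈ hC, χ ⟨x, hx⟩ = ψ ⟨x, hx⟩ := by
    intro x hx
    induction hx using Submodule.span_induction with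
    | mem x hx =>
      rcases hx with ⟨hx, hk⟩ | hx
      · exact ⟨hx, h2 x hx hk⟩
      · exact ⟨hah x hx, h1 x hx⟩
    | zero => exact ⟨hC.zero_mem, (map_zero χ).trans (map_zero ψ).symm⟩
    | add v w _ _ hv hw =>
      obtain ⟨hv, ev⟩ := hv
      obtain ⟨hw, ew⟩ := hw
      refine ⟨hC.add_mem hv hw, ?_⟩
      have e1 := map_add χ ⟨v, hv⟩ ⟨w, hw⟩
      have e2 := map_add ψ ⟨v, hv⟩ ⟨w, hw⟩
      rw [ev, ew, ← e2] at e1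
      exact e1
    | smul c v _ hv =>
      obtain ⟨hv, ev⟩ := hv
      refine ⟨hC.smul_mem c hv, ?_⟩
      have e1 := map_smul χ c ⟨v, hv⟩
      have e2 := map_smul ψ c ⟨v, hv⟩
      rw [ev, ← e2] at e1
      exact e1
  ext ⟨x, hx⟩
  obtain ⟨_, h⟩ := key x (by rw [hspan]; exact hx)
  exact h

/-- The conjugate `H ↦ conj (χ (τ H))` of a functional on `hC`. -/
noncomputable def conjDual {hC : LieSubalgebra ℂ gC} (τ : gC →ₗ[ℝ] gC)
    (hτconj : ∀ (c : ℂ) (x : gC), τ (c • x) = (starRingEnd ℂ) c • τ x)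
    (hst : ∀ x ∈ hC, τ x ∈ hC) (χ : Module.Dual ℂ hC) : Module.Dual ℂ hC where
  toFun H := (starRingEnd ℂ) (χ ⟨τ H, hst H H.2⟩)
  map_add' x y := by
    rw [← map_add, ← map_add]
    congr 2
    ext
    simp
  map_smul' c x := by
    have : (⟨τ ((c • x : hC) : gC), hst _ (c • x : hC).2⟩ : hC) =
        (starRingEnd ℂ) c • (⟨τ x, hst x x.2⟩ : hC) := by
      ext
      simp [hτconj]
    rw [this, map_smul, smul_eq_mul, map_mul, Complex.conj_conj]
    rfl

/-- The restriction of the highest root to `a` is the highest restricted root. -/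
lemma highest_restrict [FiniteDimensional ℂ gC] [LieAlgebra.IsSimple ℂ gC]
    (g k p a : Submodule ℝ gC) (hg : IsRealForm g)
    (hkp : IsCartanDecomposition g k p) (ha : IsMaximalAbelianIn a p)
    (P : Set (Module.Dual ℝ a)) (hP : IsPositiveSystem g a P)
    (lam : Module.Dual ℝ a) (hlam : IsHighestRestrictedRoot g a P lam)
    (hC : LieSubalgebra ℂ gC) [hC.IsCartanSubalgebra] (hah : ∀ x ∈ a, x ∈ hC)
    (hspan : Submodule.span ℂ
        ({x : gC | x ∈ hC ∧ Complex.I • x ∈ k} ∪ (a : Set gC)) = hC.toSubmodule)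
    (PC : Set (Module.Dual ℂ hC)) (hPC : IsPositiveSystemC hC PC)
    (hcompat : CompatiblePositiveSystems hC a hah PC P)
    (φ : Module.Dual ℂ hC) (hφ : IsHighestRootC hC PC φ)
    (τ : gC →ₗ[ℝ] gC)
    (hτinv : ∀ x, τ (τ x) = x)
    (hτconj : ∀ (c : ℂ) (x : gC), τ (c • x) = (starRingEnd ℂ) c • τ x)
    (hτlie : ∀ x y : gC, τ ⁅x, y⁆ = ⁅τ x, τ y⁆)
    (hτa : ∀ x ∈ a, τ x = x) (hτt : ∀ x, Complex.I • x ∈ k → τ x = -x)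
    (hst : ∀ x ∈ hC, τ x ∈ hC)
    (hreal : ∀ χ ∈ rootsC hC, ∀ x : gC, ∀ hx : x ∈ hC, Complex.I • x ∈ k →
      (starRingEnd ℂ) (χ ⟨x, hx⟩) = χ ⟨x, hx⟩) :
    ∀ x : gC, ∀ hx : x ∈ a, φ ⟨x, hah x hx⟩ = ((lam ⟨x, hx⟩ : ℝ) : ℂ) := by
  let D := conjDual τ hτconj hst
  have Dadd : ∀ χ ψ, D (χ + ψ) = D χ + D ψ := by
    intro χ ψ; ext H; simp [D, conjDual]
  have D0 : D 0 = 0 := by ext H; simp [D, conjDual]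
  have Da : ∀ χ : Module.Dual ℂ hC, ∀ x, ∀ hx : x ∈ a,
      D χ ⟨x, hah x hx⟩ = (starRingEnd ℂ) (χ ⟨x, hah x hx⟩) := by
    intro χ x hx
    simp [D, conjDual, hτa x hx]
  have Dt : ∀ χ : Module.Dual ℂ hC, ∀ x, ∀ hx : x ∈ hC, Complex.I • x ∈ k →
      D χ ⟨x, hx⟩ = - (starRingEnd ℂ) (χ ⟨x, hx⟩) := by
    intro χ x hx hk
    have : (⟨τ x, hst x hx⟩ : hC) = - ⟨x, hx⟩ := by ext; simp [hτt x hk]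
    simp [D, conjDual, this]
  -- lifts of restricted positive roots
  have lift : ∀ ξ ∈ P, ∃ χ ∈ PC,
      ∀ x : gC, ∀ hx : x ∈ a, χ ⟨x, hah x hx⟩ = ((ξ ⟨x, hx⟩ : ℝ) : ℂ) := by
    intro ξ hξ
    obtain ⟨χ, hχ, hres⟩ := exists_lift hah (hP.subset hξ)
    refine ⟨χ, ?_, hres⟩
    rcases hPC.total χ hχ with h | h
    · exact h
    · exfalso
      have hnv : ¬ VanishesOnA hC a hah (-χ) := by
        intro hv
        apply (hP.subset hξ).1
        ext H
        have h1 := hv H.1 H.2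
        have h2 := hres H.1 H.2
        rw [LinearMap.neg_apply, h2] at h1
        simpa using h1
      obtain ⟨η, hη, hηres⟩ := hcompat _ h hnv
      have : η = -ξ := by
        ext H
        have h1 := hηres H.1 H.2
        rw [LinearMap.neg_apply, hres H.1 H.2] at h1
        have : (-(ξ H) : ℝ) = η H := by exact_mod_cast h1
        simp [← this]
      exact hP.not_both ξ hξ (this ▸ hη)
  have liftc : ∀ η ∈ AddSubmonoid.closure P, ∃ δ ∈ AddSubmonoid.closure PC,
      ∀ x : gC, ∀ hx : x ∈ a, δ ⟨x, hah x hx⟩ = ((η ⟨x, hx⟩ : ℝ) : ℂ) := by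
    intro η hη
    induction hη using AddSubmonoid.closure_induction with
    | mem ξ hξ =>
      obtain ⟨χ, hχ, h⟩ := lift ξ hξ
      exact ⟨χ, AddSubmonoid.subset_closure hχ, h⟩
    | zero => exact ⟨0, AddSubmonoid.zero_mem _, by simp⟩
    | add u v _ _ hu hv =>
      obtain ⟨χ, hχ, h⟩ := hu
      obtain ⟨ψ, hψ, h'⟩ := hv
      exact ⟨χ + ψ, AddSubmonoid.add_mem _ hχ hψ, fun x hx => by
        rw [LinearMap.add_apply, h x hx, h' x hx]; simp⟩
  have hDroot : ∀ χ ∈ rootsC hC, D χ ∈ rootsC hC := by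
    rintro χ ⟨hχ0, v, hv, hv0⟩
    have hw : τ v ∈ rootSpaceC hC (D χ) := by
      intro H
      have h1 := hv ⟨τ H, hst H H.2⟩
      have h2 := congrArg τ h1
      rw [hτlie, hτconj] at h2
      simp only [hτinv] at h2
      exact h2
    refine ⟨?_, τ v, hw, fun h => hv0 (by rw [← hτinv v, h, map_zero])⟩
    intro h
    apply hχ0
    ext H
    have := LinearMap.congr_fun h ⟨τ H, hst H H.2⟩
    simpa [D, conjDual, hτinv] using this
  have claim : ∀ δ ∈ AddSubmonoid.closure PC, ∃ s : Multiset (Module.Dual ℂ hC),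
      (∀ χ ∈ s, χ ∈ PC) ∧ s.sum = δ + D δ := by
    intro δ hδ
    induction hδ using AddSubmonoid.closure_induction with
    | zero => exact ⟨0, by simp, by simp [D0]⟩
    | add u v _ _ hu hv =>
      obtain ⟨s, hs, h⟩ := hu
      obtain ⟨t, ht, h'⟩ := hv
      refine ⟨s + t, ?_, ?_⟩
      · intro χ hχ
        rcases Multiset.mem_add.mp hχ with h | h
        · exact hs _ h
        · exact ht _ h
      · rw [Multiset.sum_add, h, h', Dadd]
        abel
    | mem χ hχ =>
      by_cases hv : VanishesOnA hC a hah χ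
      · refine ⟨0, by simp, ?_⟩
        rw [Multiset.sum_zero]
        apply dual_ext hah hspan
        · intro x hx
          rw [LinearMap.add_apply, Da χ x hx, hv x hx]
          simp
        · intro x hx hk
          rw [LinearMap.add_apply, Dt _ _ _ hk, hreal χ (hPC.subset hχ) x hx hk]
          simp
      · have hmem : D χ ∈ PC := by
          obtain ⟨ξ, hξ, hres⟩ := hcompat χ hχ hv
          have hDres : ∀ x : gC, ∀ hx : x ∈ a, D χ ⟨x, hah x hx⟩ = ((ξ ⟨x, hx⟩ : ℝ) : ℂ) := by
            intro x hx
            rw [Da χ x hx, hres x hx, Complex.conj_ofReal]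
          rcases hPC.total _ (hDroot χ (hPC.subset hχ)) with h | h
          · exact h
          · exfalso
            have hnv : ¬ VanishesOnA hC a hah (-(D χ)) := by
              intro hv'
              apply hv
              intro x hx
              have h1 := hv' x hx
              rw [LinearMap.neg_apply, hDres x hx] at h1
              rw [hres x hx]
              simpa using h1
            obtain ⟨η, hη, hηres⟩ := hcompat _ h hnv
            have : η = -ξ := by
              ext H
              have h1 := hηres H.1 H.2
              rw [LinearMap.neg_apply, hDres H.1 H.2] at h1
              have : (-(ξ H) : ℝ) = η H := by exact_mod_cast h1
              simp [← this]
            exact hP.not_both ξ hξ (this ▸ hη)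
        refine ⟨{χ, D χ}, ?_, by simp⟩
        intro ψ hψ
        simp only [Multiset.insert_eq_cons, Multiset.mem_cons, Multiset.mem_singleton] at hψ
        rcases hψ with rfl | rfl
        · exact hχ
        · exact hmem
  have clreal : ∀ δ ∈ AddSubmonoid.closure PC, ∀ x : gC, ∀ hx : x ∈ hC, Complex.I • x ∈ k →
      (starRingEnd ℂ) (δ ⟨x, hx⟩) = δ ⟨x, hx⟩ := by
    intro δ hδ x hx hk
    induction hδ using AddSubmonoid.closure_induction with
    | zero => simp
    | add u v _ _ hu hv => simp [hu, hv]
    | mem χ hχ => exact hreal χ (hPC.subset hχ) x hx hk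
  -- the restriction of `φ`
  obtain ⟨ξ, hξres, hξcl⟩ : ∃ ξ : Module.Dual ℝ a,
      (∀ x : gC, ∀ hx : x ∈ a, φ ⟨x, hah x hx⟩ = ((ξ ⟨x, hx⟩ : ℝ) : ℂ)) ∧
      lam - ξ ∈ AddSubmonoid.closure P := by
    by_cases hv : VanishesOnA hC a hah φ
    · refine ⟨0, fun x hx => by rw [hv x hx]; simp, ?_⟩
      rw [sub_zero]
      exact AddSubmonoid.subset_closure hlam.1
    · obtain ⟨ξ, hξ, hres⟩ := hcompat φ hφ.1 hv
      exact ⟨ξ, hres, hlam.2 ξ (hP.subset hξ)⟩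
  obtain ⟨χ, hχ, hχres⟩ := lift lam hlam.1
  have hδ1 := hφ.2 χ (hPC.subset hχ)
  obtain ⟨δ2, hδ2, hδ2res⟩ := liftc _ hξcl
  obtain ⟨s1, hs1, hs1sum⟩ := claim _ hδ1
  obtain ⟨s2, hs2, hs2sum⟩ := claim _ hδ2
  have hsum0 : (s1 + s2).sum = 0 := by
    rw [Multiset.sum_add, hs1sum, hs2sum]
    apply dual_ext hah hspan
    · intro x hx
      simp only [LinearMap.add_apply, LinearMap.sub_apply, Da _ x hx, hδ2res x hx, hχres x hx,
        hξres x hx, map_sub, Complex.conj_ofReal, LinearMap.zero_apply]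
      push_cast
      ring
    · intro x hx hk
      have e1 := clreal _ hδ1 x hx hk
      have e2 := clreal _ hδ2 x hx hk
      simp only [LinearMap.add_apply, Dt _ _ _ hk, e1, e2, LinearMap.zero_apply]
      ring
  have hs0 : s1 + s2 = 0 := pointed_s11 hPC _ _ rfl (by
    intro χ hχ
    rcases Multiset.mem_add.mp hχ with h | h
    · exact hs1 _ h
    · exact hs2 _ h) hsum0
  have hs10 : s1 = 0 := (add_eq_zero.mp hs0).1
  rw [hs10, Multiset.sum_zero] at hs1sum
  intro x hx
  have h := LinearMap.congr_fun hs1sum ⟨x, hah x hx⟩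
  simp only [LinearMap.add_apply, LinearMap.sub_apply, Da _ x hx, hχres x hx, hξres x hx, map_sub,
    Complex.conj_ofReal, LinearMap.zero_apply] at h
  rw [hξres x hx]
  linear_combination -h / 2

/-- **Lemma 5.2 (Okuda).** With `τ` the conjugation of `gC` with respect to `g`,
`Alam ∈ a` the coroot of the highest restricted root `lam` and `Hphi ∈ h` the coroot of
the highest root `φ` of `Δ⁺(gC,hC)` (realized through their Killing-dual vectors
`tlam, tphi`), one has `Alam = (⟨φ,φ⟩ / (2⟨lam,lam⟩)) • (Hphi + τ Hphi)`, where
`⟨φ,φ⟩ = κ(tphi,tphi)` and `⟨lam,lam⟩ = κ(tlam,tlam)` are the inner products induced by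
the Killing form `κ`.  In particular, if `φ` is a real root then `Alam = Hphi`. -/
theorem coroot_formula_via_killing_duals
    {gC : Type*} [LieRing gC] [LieAlgebra ℂ gC] [FiniteDimensional ℂ gC]
    [LieAlgebra.IsSimple ℂ gC]
    (g k p a : Submodule ℝ gC) (hg : IsRealForm g)
    (hkp : IsCartanDecomposition g k p) (hnoncompact : p ≠ ⊥)
    (ha : IsMaximalAbelianIn a p)
    (P : Set (Module.Dual ℝ a)) (hP : IsPositiveSystem g a P)
    (lam : Module.Dual ℝ a) (hlam : IsHighestRestrictedRoot g a P lam)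
    (hC : LieSubalgebra ℂ gC) [hC.IsCartanSubalgebra] (hah : ∀ x ∈ a, x ∈ hC)
    (hspan : Submodule.span ℂ
        ({x : gC | x ∈ hC ∧ Complex.I • x ∈ k} ∪ (a : Set gC)) = hC.toSubmodule)
    (PC : Set (Module.Dual ℂ hC)) (hPC : IsPositiveSystemC hC PC)
    (hcompat : CompatiblePositiveSystems hC a hah PC P)
    (φ : Module.Dual ℂ hC) (hφ : IsHighestRootC hC PC φ)
    (τ : gC →ₗ[ℝ] gC)
    (hτinv : ∀ x, τ (τ x) = x)
    (hτconj : ∀ (c : ℂ) (x : gC), τ (c • x) = (starRingEnd ℂ) c • τ x)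
    (hτfix : ∀ x : gC, τ x = x ↔ x ∈ g)
    (hτlie : ∀ x y : gC, τ ⁅x, y⁆ = ⁅τ x, τ y⁆)
    (tlam : gC) (htlama : tlam ∈ a)
    (htlamdual : ∀ A' : a, killingForm ℂ gC tlam A' = ((lam A' : ℝ) : ℂ))
    (Alam : gC) (hAlam : Alam = (2 / killingForm ℂ gC tlam tlam) • tlam)
    (tphi : gC) (htphi : tphi ∈ hC)
    (htphidual : ∀ H : hC, killingForm ℂ gC tphi H = φ H)
    (Hphi : gC) (hHphi : Hphi = (2 / killingForm ℂ gC tphi tphi) • tphi) :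
    Alam = (killingForm ℂ gC tphi tphi / (2 * killingForm ℂ gC tlam tlam)) •
        (Hphi + τ Hphi) ∧
    (IsRealRootWRT hC k φ → Alam = Hphi) := by
  have hτa : ∀ x ∈ a, τ x = x := fun x hx => (hτfix x).mpr (hkp.p_le (ha.le hx))
  have hτt : ∀ x, Complex.I • x ∈ k → τ x = -x := by
    intro x hx
    have h := (hτfix _).mpr (hkp.k_le hx)
    rw [hτconj, Complex.conj_I] at h
    have h2 := congrArg (fun y => Complex.I • y) h
    simpa [smul_smul] using h2
  have hst : ∀ x ∈ hC, τ x ∈ hC := by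
    intro x hx
    have hx' : x ∈ Submodule.span ℂ
        ({x : gC | x ∈ hC ∧ Complex.I • x ∈ k} ∪ (a : Set gC)) := by
      rw [hspan]; exact hx
    clear hx
    induction hx' using Submodule.span_induction with
    | mem x hx =>
      rcases hx with ⟨hx, hk⟩ | hx
      · rw [hτt x hk]; exact neg_mem hx
      · rw [hτa x hx]; exact hah x hx
    | zero => rw [map_zero]; exact hC.zero_mem
    | add v w _ _ hv hw => rw [map_add]; exact hC.add_mem hv hw
    | smul c v _ hv => rw [hτconj]; exact hC.smul_mem _ hv
  have hreal : ∀ χ ∈ rootsC hC, ∀ x : gC, ∀ hx : x ∈ hC, Complex.I • x ∈ k →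
      (starRingEnd ℂ) (χ ⟨x, hx⟩) = χ ⟨x, hx⟩ := by
    rintro χ ⟨-, v, hv, hv0⟩ x hx hk
    have h1 : ⁅Complex.I • x, v⁆ = (Complex.I * χ ⟨x, hx⟩) • v := by
      rw [smul_lie, mul_smul]
      congr 1
      exact hv ⟨x, hx⟩
    have h2 := conj_eigenvalue hg hkp hk hv0 h1
    rw [map_mul, Complex.conj_I] at h2
    have h3 : Complex.I * ((starRingEnd ℂ) (χ ⟨x, hx⟩)) = Complex.I * χ ⟨x, hx⟩ := by
      linear_combination -h2
    exact mul_left_cancel₀ Complex.I_ne_zero h3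
  have hres := highest_restrict g k p a hg hkp ha P hP lam hlam hC hah hspan PC hPC hcompat φ hφ
    τ hτinv hτconj hτlie hτa hτt hst hreal
  have hφroot : φ ∈ rootsC hC := hPC.subset hφ.1
  have hκ := killing_conj τ hτinv hτconj hτlie
  have hsymm : ∀ x y : gC, killingForm ℂ gC x y = killingForm ℂ gC y x :=
    LieModule.traceForm_comm ℂ gC gC
  -- an element of `hC` orthogonal to `hC` vanishes
  have hnd : ∀ z ∈ hC, (∀ H : hC, killingForm ℂ gC z H = 0) → z = 0 := by
    intro z hz h
    have hn := LieAlgebra.IsKilling.traceForm_cartan_nondegenerate ℂ gC hC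
    have := hn.1 ⟨z, hz⟩ (fun H => h H)
    exact congrArg Subtype.val this
  have hlamk : ∀ x, Complex.I • x ∈ k → killingForm ℂ gC tlam x = 0 := by
    intro x hk
    have h := killing_kp hg hkp hk (ha.le htlama)
    rw [hsymm, map_smul, smul_eq_mul] at h
    exact (mul_eq_zero.mp h).resolve_left Complex.I_ne_zero
  -- orthogonality can be tested on `a` and `√-1 t`
  have htest : ∀ z ∈ hC, (∀ x ∈ a, killingForm ℂ gC z x = 0) →
      (∀ x ∈ hC, Complex.I • x ∈ k → killingForm ℂ gC z x = 0) → z = 0 := by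
    intro z hz h1 h2
    apply hnd z hz
    have : (killingForm ℂ gC z).comp hC.toSubmodule.subtype = (0 : Module.Dual ℂ hC) :=
      dual_ext hah hspan (fun x hx => h1 x hx) (fun x hx hk => h2 x hx hk)
    intro H
    exact LinearMap.congr_fun this H
  have htlamC : tlam ∈ hC := hah _ htlama
  have hφa : ∀ x, ∀ hx : x ∈ a, killingForm ℂ gC tphi x = ((lam ⟨x, hx⟩ : ℝ) : ℂ) := by
    intro x hx
    rw [← hres x hx]
    exact htphidual ⟨x, hah x hx⟩
  have hsum : tphi + τ tphi = (2 : ℂ) • tlam := by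
    rw [← sub_eq_zero]
    apply htest _ (sub_mem (add_mem htphi (hst _ htphi)) (hC.smul_mem _ htlamC))
    · intro x hx
      have e1 : killingForm ℂ gC (τ tphi) x = ((lam ⟨x, hx⟩ : ℝ) : ℂ) := by
        have h := hκ tphi x
        rw [hτa x hx, hφa x hx, Complex.conj_ofReal] at h
        exact h
      have e2 := htlamdual ⟨x, hx⟩
      simp only [map_sub, map_add, map_smul, LinearMap.sub_apply, LinearMap.add_apply,
        LinearMap.smul_apply, smul_eq_mul, e1, hφa x hx]
      linear_combination -2 * e2
    · intro x hx hk
      have e0 := htphidual ⟨x, hx⟩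
      have e1 : killingForm ℂ gC (τ tphi) x = - φ ⟨x, hx⟩ := by
        have h := hκ tphi (τ x)
        rw [hτinv, hτt x hk, map_neg, e0, map_neg, hreal φ hφroot x hx hk] at h
        exact h
      simp only [map_sub, map_add, map_smul, LinearMap.sub_apply, LinearMap.add_apply,
        LinearMap.smul_apply, smul_eq_mul, e1, hlamk x hk]
      linear_combination e0
  have hll : killingForm ℂ gC tphi tlam = killingForm ℂ gC tlam tlam :=
    (hφa tlam htlama).trans (htlamdual ⟨tlam, htlama⟩).symm
  have hconjφ : (starRingEnd ℂ) (killingForm ℂ gC tphi tphi) = killingForm ℂ gC tphi tphi := by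
    have h := hκ tphi tphi
    rw [eq_sub_of_add_eq' hsum] at h
    simp only [map_sub, map_smul, LinearMap.sub_apply, LinearMap.smul_apply, smul_eq_mul] at h
    rw [hsymm tlam tphi, hll] at h
    linear_combination -h
  have hne : killingForm ℂ gC tphi tphi ≠ 0 := by
    obtain ⟨i, hi⟩ := exists_weight_of_mem_rootsC hφroot
    have hnz : i.1.IsNonZero := (LieSubalgebra.isNonZero_coe_root i)
    have h := LieAlgebra.IsKilling.root_apply_cartanEquivDual_symm_ne_zero hnz
    have hte : (LieAlgebra.IsKilling.cartanEquivDual hC).symm i.1 = ⟨tphi, htphi⟩ := by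
      rw [LinearEquiv.symm_apply_eq]
      ext H
      have h1 := htphidual H
      rw [← hi] at h1
      exact h1.symm
    rw [hte] at h
    have h2 := htphidual ⟨tphi, htphi⟩
    rw [← hi] at h2
    intro h0
    exact h (h2.symm.trans h0)
  refine ⟨?_, ?_⟩
  · have hτH : τ Hphi = (2 / killingForm ℂ gC tphi tphi) • τ tphi := by
      rw [hHphi, hτconj, map_div₀, hconjφ, Complex.conj_ofNat]
    rw [hτH, hHphi, ← smul_add, hsum, hAlam, smul_smul, smul_smul]
    congr 1
    by_cases h0 : killingForm ℂ gC tlam tlam = 0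
    · simp [h0]
    · field_simp
  · intro hr
    have heq : tphi = tlam := by
      rw [← sub_eq_zero]
      apply htest _ (sub_mem htphi htlamC)
      · intro x hx
        have e2 := htlamdual ⟨x, hx⟩
        rw [map_sub, LinearMap.sub_apply, hφa x hx]
        linear_combination -e2
      · intro x hx hk
        have e0 := htphidual ⟨x, hx⟩
        rw [hr x hx hk] at e0
        rw [map_sub, LinearMap.sub_apply, hlamk x hk]
        linear_combination e0
    rw [hAlam, hHphi, heq]

end SmallestOrbitPaper
end
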